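/- Let S be a nonempty set of prime numbers such that A = ℤ_S contains a unit λ with λ² − 1 also a unit in A, and let q be a prime number not in S. Then the cokernel of the homomorphism H₂(SL₂(ℤ_S), ℤ) → H₂(SL₂(ℤ_{S∪{q}}), ℤ) induced by the ring inclusion ℤ_S ⊆ ℤ_{S∪{q}} is isomorphic to the multiplicative group (ℤ/qℤ)^×. -/

import Mathlib

open Finsupp

set_option maxHeartbeats 1000000
set_option synthInstance.maxHeartbeats 400000

/-- `ℤ_S`: the subring of `ℚ` obtained by localizing `ℤ` at the primes in `S`, i.e. the smallest
subring of `ℚ` containing the inverses of the elements of `S`. -/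
def ZS (S : Set ℕ) : Subring ℚ :=
  Subring.closure ((fun p : ℕ => (p : ℚ)⁻¹) '' S)





noncomputable section

/-- Degree-2 differential of the bar complex of `G` with trivial `ℤ` coefficients:
`d₂([g|h]) = [h] - [gh] + [g]`. -/
def barD2 (G : Type*) [Group G] : ((G × G) →₀ ℤ) →ₗ[ℤ] (G →₀ ℤ) :=
  Finsupp.lsum ℤ fun p => LinearMap.toSpanSingleton ℤ _
    (Finsupp.single p.2 1 - Finsupp.single (p.1 * p.2) 1 + Finsupp.single p.1 1)

/-- Degree-3 differential of the bar complex of `G` with trivial `ℤ` coefficients: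
`d₃([g|h|k]) = [h|k] - [gh|k] + [g|hk] - [g|h]`. -/
def barD3 (G : Type*) [Group G] : ((G × G × G) →₀ ℤ) →ₗ[ℤ] ((G × G) →₀ ℤ) :=
  Finsupp.lsum ℤ fun t => LinearMap.toSpanSingleton ℤ _
    (Finsupp.single (t.2.1, t.2.2) 1 - Finsupp.single (t.1 * t.2.1, t.2.2) 1 +
      Finsupp.single (t.1, t.2.1 * t.2.2) 1 - Finsupp.single (t.1, t.2.1) 1)

/-- The second homology group `H₂(G, ℤ)` of a group `G` with trivial integer coefficients,
computed via the bar complex: 2-cycles modulo 2-boundaries. -/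
abbrev H2 (G : Type*) [Group G] :=
  ↥(LinearMap.ker (barD2 G)) ⧸
    (LinearMap.range (barD3 G)).comap (LinearMap.ker (barD2 G)).subtype

variable {G G' : Type*} [Group G] [Group G']

/-- The map on degree-1 bar chains induced by a group homomorphism. -/
def mapC1 (f : G →* G') : (G →₀ ℤ) →ₗ[ℤ] (G' →₀ ℤ) :=
  Finsupp.lmapDomain ℤ ℤ f

/-- The map on degree-2 bar chains induced by a group homomorphism. -/
def mapC2 (f : G →* G') : ((G × G) →₀ ℤ) →ₗ[ℤ] ((G' × G') →₀ ℤ) :=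
  Finsupp.lmapDomain ℤ ℤ (Prod.map f f)

/-- The map on degree-3 bar chains induced by a group homomorphism. -/
def mapC3 (f : G →* G') : ((G × G × G) →₀ ℤ) →ₗ[ℤ] ((G' × G' × G') →₀ ℤ) :=
  Finsupp.lmapDomain ℤ ℤ (fun t => (f t.1, f t.2.1, f t.2.2))

lemma mapC1_single (f : G →* G') (a : G) (b : ℤ) :
    mapC1 f (Finsupp.single a b) = Finsupp.single (f a) b := by
  simp [mapC1, Finsupp.lmapDomain_apply, Finsupp.mapDomain_single]

lemma mapC2_single (f : G →* G') (a : G × G) (b : ℤ) :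
    mapC2 f (Finsupp.single a b) = Finsupp.single (f a.1, f a.2) b := by
  simp [mapC2, Finsupp.lmapDomain_apply, Finsupp.mapDomain_single, Prod.map]

lemma mapC3_single (f : G →* G') (a : G × G × G) (b : ℤ) :
    mapC3 f (Finsupp.single a b) = Finsupp.single (f a.1, f a.2.1, f a.2.2) b := by
  simp [mapC3, Finsupp.lmapDomain_apply, Finsupp.mapDomain_single]

lemma barD2_comm (f : G →* G') :
    (barD2 G').comp (mapC2 f) = (mapC1 f).comp (barD2 G) := by
  apply Finsupp.lhom_ext
  intro p b
  simp only [LinearMap.comp_apply, mapC2_single, barD2, Finsupp.lsum_single,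
    LinearMap.toSpanSingleton_apply, map_smul, map_add, map_sub, mapC1_single, map_mul]

lemma barD3_comm (f : G →* G') :
    (barD3 G').comp (mapC3 f) = (mapC2 f).comp (barD3 G) := by
  apply Finsupp.lhom_ext
  intro t b
  simp only [LinearMap.comp_apply, mapC3_single, barD3, Finsupp.lsum_single,
    LinearMap.toSpanSingleton_apply, map_smul, map_add, map_sub, mapC2_single, map_mul]

/-- The map `H₂(G, ℤ) → H₂(G′, ℤ)` induced by a group homomorphism `f : G → G′`. -/
def mapH2 (f : G →* G') : H2 G →ₗ[ℤ] H2 G' :=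
  Submodule.mapQ _ _
    ((mapC2 f).restrict (p := LinearMap.ker (barD2 G)) (q := LinearMap.ker (barD2 G'))
      (fun x hx => by
        have := LinearMap.congr_fun (barD2_comm f) x
        simp only [LinearMap.comp_apply] at this
        simp only [LinearMap.mem_ker] at hx ⊢
        rw [this, hx, map_zero]))
    (by
      rintro ⟨x, hx⟩ hmem
      simp only [Submodule.mem_comap, LinearMap.mem_range, Submodule.coe_subtype] at hmem ⊢
      obtain ⟨z, hz⟩ := hmem
      refine ⟨mapC3 f z, ?_⟩
      have := LinearMap.congr_fun (barD3_comm f) z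
      simp only [LinearMap.comp_apply] at this
      rw [this, hz]
      rfl)

namespace RankOne

variable {F Q : Type*} [Field F] [Group Q]

/-- The Weyl element `x(u) y(-u⁻¹) x(u)` attached to two families of root elements. -/
def weyl (X Y : F → Q) (u : F) : Q := X u * Y (-u⁻¹) * X u

/-- The torus element `w(u) w(-1)` attached to two families of root elements. -/
def torus (X Y : F → Q) (u : F) : Q := weyl X Y u * weyl X Y (-1)

/-- Two families of root elements satisfying the Steinberg relations of rank one, with commuting
torus elements. -/
structure Relations (X Y : F → Q) : Prop where
  X_add : ∀ s t, X (s + t) = X s * X t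
  Y_add : ∀ s t, Y (s + t) = Y s * Y t
  weyl_X : ∀ u t, u ≠ 0 → weyl X Y u * X t * (weyl X Y u)⁻¹ = Y (-(t / u ^ 2))
  weyl_Y : ∀ u t, u ≠ 0 → weyl X Y u * Y t * (weyl X Y u)⁻¹ = X (-(u ^ 2 * t))
  torus_comm : ∀ u v, u ≠ 0 → v ≠ 0 → torus X Y u * torus X Y v = torus X Y v * torus X Y u

namespace Relations

variable {X Y : F → Q} (H : Relations X Y)

local notation "w" => weyl X Y
local notation "h" => torus X Y

include H

lemma X_zero : X 0 = 1 := by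
  have := H.X_add 0 0
  rw [add_zero] at this
  exact left_eq_mul.mp this

lemma Y_zero : Y 0 = 1 := by
  have := H.Y_add 0 0
  rw [add_zero] at this
  exact left_eq_mul.mp this

lemma X_neg (t : F) : X (-t) = (X t)⁻¹ := by
  rw [eq_inv_iff_mul_eq_one, ← H.X_add, neg_add_cancel, H.X_zero]

lemma Y_neg (t : F) : Y (-t) = (Y t)⁻¹ := by
  rw [eq_inv_iff_mul_eq_one, ← H.Y_add, neg_add_cancel, H.Y_zero]

lemma weyl_neg (u : F) : w (-u) = (w u)⁻¹ := by
  simp only [weyl, H.X_neg, inv_neg, mul_inv_rev, neg_neg, mul_assoc]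
  rw [← H.Y_neg, neg_neg]

lemma weyl_mul_X (u t : F) (hu : u ≠ 0) : w u * X t = Y (-(t / u ^ 2)) * w u := by
  rw [← H.weyl_X u t hu, inv_mul_cancel_right]

lemma weyl_mul_Y (u t : F) (hu : u ≠ 0) : w u * Y t = X (-(u ^ 2 * t)) * w u := by
  rw [← H.weyl_Y u t hu, inv_mul_cancel_right]

lemma torus_mul_X (u t : F) (hu : u ≠ 0) : h u * X t = X (u ^ 2 * t) * h u := by
  rw [torus, mul_assoc, H.weyl_mul_X _ _ (by simp), ← mul_assoc, H.weyl_mul_Y _ _ hu, mul_assoc]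
  congr 2
  ring

lemma torus_mul_Y (u t : F) (hu : u ≠ 0) : h u * Y t = Y (t / u ^ 2) * h u := by
  rw [torus, mul_assoc, H.weyl_mul_Y _ _ (by simp), ← mul_assoc, H.weyl_mul_X _ _ hu, mul_assoc]
  congr 2
  ring

lemma torus_mul_weyl (u v : F) (hu : u ≠ 0) : h u * w v = w (u ^ 2 * v) * h u := by
  have e : -v⁻¹ / u ^ 2 = -(u ^ 2 * v)⁻¹ := by
    rw [mul_inv, mul_comm, neg_div, div_eq_mul_inv]
  rw [weyl, ← mul_assoc, ← mul_assoc, H.torus_mul_X _ _ hu, mul_assoc (X _), H.torus_mul_Y _ _ hu,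
    ← mul_assoc (X _), mul_assoc _ (h u), H.torus_mul_X _ _ hu, ← mul_assoc, weyl, e]

lemma torus_one : h 1 = 1 := by
  rw [torus, H.weyl_neg, mul_inv_cancel]

lemma weyl_eq (u : F) : w u = h u * w 1 := by
  rw [torus, H.weyl_neg, inv_mul_cancel_right]

lemma torus_sq_mul (u v : F) (hu : u ≠ 0) (hv : v ≠ 0) : h (u ^ 2 * v) = h (u ^ 2) * h v := by
  have e : h v * h u = w (u ^ 2 * v) * w (-u ^ 2) * h u := by
    rw [← H.torus_comm u v hu hv]
    conv_lhs => rw [torus.eq_1 X Y v, ← mul_assoc, H.torus_mul_weyl _ _ hu, mul_assoc,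
      H.torus_mul_weyl _ _ hu, ← mul_assoc]
    simp
  have e' := mul_right_cancel e
  rw [H.torus_comm _ _ (pow_ne_zero 2 hu) hv, e', H.weyl_neg]
  simp only [torus]
  group

lemma Y_eq (r : F) : Y r = X r⁻¹ * w (-r⁻¹) * X r⁻¹ := by
  simp only [weyl, H.X_neg, inv_neg, inv_inv, neg_neg]
  group

lemma weyl_weyl_weyl (a b : F) (ha : a ≠ 0) (hb : b ≠ 0) (hab : a + b ≠ 0) :
    w (-a) * w (-b) * w (b ^ 2 / (a + b)) = w (-(a * b / (a + b))) := by
  have h1 : X a * w (-a) * X (a + b) * w (-b) * X b =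
      X (a * b / (a + b)) * w (-(a * b / (a + b))) * X (a * b / (a + b)) := by
    have e1 := H.Y_eq a⁻¹
    have e2 := H.Y_eq b⁻¹
    have e3 := H.Y_eq (a⁻¹ + b⁻¹)
    have e4 : (a⁻¹ + b⁻¹)⁻¹ = a * b / (a + b) := by
      rw [inv_add_inv ha hb, inv_div]
    rw [e4, H.Y_add, e1, e2] at e3
    rw [← e3, H.X_add]
    simp only [inv_inv, mul_assoc]
  have h2 : X (a + b) * w (-b) = w (-b) * Y (-((a + b) / b ^ 2)) := by
    rw [H.weyl_mul_Y _ _ (neg_ne_zero.mpr hb)]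
    congr 2
    field_simp
  have h3 := H.Y_eq (-((a + b) / b ^ 2))
  have e5 : (-((a + b) / b ^ 2))⁻¹ = -(b ^ 2 / (a + b)) := by rw [inv_neg, inv_div]
  rw [e5, neg_neg] at h3
  have h4 : w (-a) * w (-b) * X (-(b ^ 2 / (a + b))) =
      X (-(a ^ 2 / (a + b))) * (w (-a) * w (-b)) := by
    rw [mul_assoc, H.weyl_mul_X _ _ (neg_ne_zero.mpr hb), ← mul_assoc,
      H.weyl_mul_Y _ _ (neg_ne_zero.mpr ha), mul_assoc]
    congr 2
    field_simp
  have h5 : X a * (X (-(a ^ 2 / (a + b))) * (w (-a) * w (-b))) * w (b ^ 2 / (a + b)) *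
      (X (-(b ^ 2 / (a + b))) * X b) =
      X (a * b / (a + b)) * w (-(a * b / (a + b))) * X (a * b / (a + b)) := by
    have h2' : ∀ z, X (a + b) * (w (-b) * z) = w (-b) * (Y (-((a + b) / b ^ 2)) * z) := fun z => by
      rw [← mul_assoc, h2, mul_assoc]
    rw [← h1, ← h4]
    simp only [mul_assoc, h2', h3]
  have e6 : a * b / (a + b) = a + -(a ^ 2 / (a + b)) := by field_simp; ring
  have e7 : a * b / (a + b) = -(b ^ 2 / (a + b)) + b := by field_simp; ring
  have h6 : X a * X (-(a ^ 2 / (a + b))) = X (a * b / (a + b)) := by rw [← H.X_add, ← e6]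
  have h7 : X (-(b ^ 2 / (a + b))) * X b = X (a * b / (a + b)) := by rw [← H.X_add, ← e7]
  rw [h7, ← mul_assoc (X a), h6] at h5
  have h8 := mul_right_cancel h5
  rw [mul_assoc (X _)] at h8
  exact mul_left_cancel h8

lemma torus_steinberg (u : F) (hu : u ≠ 0) (hu1 : 1 - u ≠ 0) :
    h u * h (1 - u)⁻¹ = h (u * (1 - u)⁻¹) := by
  have e := H.weyl_weyl_weyl (-u) 1 (neg_ne_zero.mpr hu) one_ne_zero
    (by rwa [add_comm, ← sub_eq_add_neg])
  have e1 : (1 : F) ^ 2 / (-u + 1) = (1 - u)⁻¹ := by rw [one_pow, one_div, neg_add_eq_sub]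
  have e2 : -(-u * 1 / (-u + 1)) = u * (1 - u)⁻¹ := by
    rw [neg_add_eq_sub, mul_one, neg_div, neg_neg, div_eq_mul_inv]
  rw [neg_neg, e1, e2] at e
  simp only [torus] at e ⊢
  rw [← e]
  simp only [mul_assoc]

end Relations

end RankOne

namespace SLTwo

open Matrix
open scoped commutatorElement

section CommRing

variable {R : Type*} [CommRing R]

lemma ext_entries {g k : SpecialLinearGroup (Fin 2) R} (h00 : g 0 0 = k 0 0) (h01 : g 0 1 = k 0 1)
    (h10 : g 1 0 = k 1 0) (h11 : g 1 1 = k 1 1) : g = k := by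
  ext i j
  fin_cases i <;> fin_cases j <;> assumption

lemma mul_entry (g k : SpecialLinearGroup (Fin 2) R) (i j : Fin 2) :
    (g * k) i j = g i 0 * k 0 j + g i 1 * k 1 j := by
  change (g.1 * k.1) i j = _
  rw [Matrix.mul_apply, Fin.sum_univ_two]

lemma inv_entry (g : SpecialLinearGroup (Fin 2) R) :
    g⁻¹ 0 0 = g 1 1 ∧ g⁻¹ 0 1 = -g 0 1 ∧ g⁻¹ 1 0 = -g 1 0 ∧ g⁻¹ 1 1 = g 0 0 := by
  have e : (g⁻¹).1 = _ := Matrix.adjugate_fin_two g.1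
  rw [e]
  exact ⟨rfl, rfl, rfl, rfl⟩

lemma det_entries (g : SpecialLinearGroup (Fin 2) R) : g 0 0 * g 1 1 - g 0 1 * g 1 0 = 1 := by
  rw [← Matrix.det_fin_two, g.det_coe]

lemma one_entry : (1 : SpecialLinearGroup (Fin 2) R) 0 0 = 1 ∧
    (1 : SpecialLinearGroup (Fin 2) R) 0 1 = 0 ∧ (1 : SpecialLinearGroup (Fin 2) R) 1 0 = 0 ∧
    (1 : SpecialLinearGroup (Fin 2) R) 1 1 = 1 := by
  simp

/-- The matrix of determinant one with prescribed entries. -/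
def mk (a b c d : R) (h : a * d - b * c = 1) : SpecialLinearGroup (Fin 2) R :=
  ⟨!![a, b; c, d], by rw [Matrix.det_fin_two_of, h]⟩

lemma mk_entry (a b c d : R) (h : a * d - b * c = 1) :
    mk a b c d h 0 0 = a ∧ mk a b c d h 0 1 = b ∧ mk a b c d h 1 0 = c ∧ mk a b c d h 1 1 = d :=
  ⟨rfl, rfl, rfl, rfl⟩

/-- Upper triangular elementary matrices. -/
def up (t : R) : SpecialLinearGroup (Fin 2) R := mk 1 t 0 1 (by ring)

/-- Lower triangular elementary matrices. -/
def lo (t : R) : SpecialLinearGroup (Fin 2) R := mk 1 0 t 1 (by ring)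

/-- Diagonal matrices. -/
def diag (u : Rˣ) : SpecialLinearGroup (Fin 2) R := mk u 0 0 ↑u⁻¹ (by simp)

/-- The matrix of the nontrivial element of the Weyl group. -/
def wey : SpecialLinearGroup (Fin 2) R := mk 0 1 (-1) 0 (by ring)

/-- Rewriting rules computing the entries of products of matrices. -/
lemma up_entry (t : R) : up t 0 0 = 1 ∧ up t 0 1 = t ∧ up t 1 0 = 0 ∧ up t 1 1 = 1 :=
  ⟨rfl, rfl, rfl, rfl⟩

lemma lo_entry (t : R) : lo t 0 0 = 1 ∧ lo t 0 1 = 0 ∧ lo t 1 0 = t ∧ lo t 1 1 = 1 :=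
  ⟨rfl, rfl, rfl, rfl⟩

lemma diag_entry (u : Rˣ) :
    diag u 0 0 = u ∧ diag u 0 1 = 0 ∧ diag u 1 0 = 0 ∧ diag u 1 1 = ↑u⁻¹ :=
  ⟨rfl, rfl, rfl, rfl⟩

lemma wey_entry : (wey : SpecialLinearGroup (Fin 2) R) 0 0 = 0 ∧
    (wey : SpecialLinearGroup (Fin 2) R) 0 1 = 1 ∧ (wey : SpecialLinearGroup (Fin 2) R) 1 0 = -1 ∧
    (wey : SpecialLinearGroup (Fin 2) R) 1 1 = 0 :=
  ⟨rfl, rfl, rfl, rfl⟩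

lemma up_add (s t : R) : up (s + t) = up s * up t := by
  apply ext_entries <;> simp [mul_entry, up_entry, add_comm]

lemma lo_add (s t : R) : lo (s + t) = lo s * lo t := by
  apply ext_entries <;> simp [mul_entry, lo_entry]

lemma up_zero : up (0 : R) = 1 := by
  apply ext_entries <;> simp [up_entry, one_entry]

lemma lo_zero : lo (0 : R) = 1 := by
  apply ext_entries <;> simp [lo_entry, one_entry]

lemma up_neg (t : R) : up (-t) = (up t)⁻¹ := by
  apply ext_entries <;> simp [up_entry, inv_entry]

lemma lo_neg (t : R) : lo (-t) = (lo t)⁻¹ := by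
  apply ext_entries <;> simp [lo_entry, inv_entry]

lemma diag_mul (u v : Rˣ) : diag (u * v) = diag u * diag v := by
  apply ext_entries <;> simp [mul_entry, diag_entry, mul_comm]

lemma diag_inv (u : Rˣ) : diag u⁻¹ = (diag u)⁻¹ := by
  apply ext_entries <;> simp [diag_entry, inv_entry]

lemma diag_conj_up (u : Rˣ) (t : R) : diag u * up t * (diag u)⁻¹ = up (u ^ 2 * t) := by
  apply ext_entries <;> simp [mul_entry, diag_entry, inv_entry, up_entry]
  ring

lemma diag_conj_lo (u : Rˣ) (t : R) : diag u * lo t * (diag u)⁻¹ = lo (↑u⁻¹ ^ 2 * t) := by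
  apply ext_entries <;> simp [mul_entry, diag_entry, inv_entry, lo_entry]
  ring

lemma wey_conj_up (t : R) : wey * up t * wey⁻¹ = lo (-t) := by
  apply ext_entries <;> simp [mul_entry, wey_entry, inv_entry, up_entry, lo_entry]

lemma wey_conj_diag (u : Rˣ) : wey * diag u * wey⁻¹ = diag u⁻¹ := by
  apply ext_entries <;> simp [mul_entry, wey_entry, inv_entry, diag_entry]

lemma commutator_diag_up (u : Rˣ) (t : R) : ⁅diag u, up t⁆ = up ((u ^ 2 - 1) * t) := by
  rw [commutatorElement_def, diag_conj_up, ← up_neg, ← up_add]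
  congr 1
  ring

lemma commutator_diag_lo (u : Rˣ) (t : R) : ⁅diag u⁻¹, lo t⁆ = lo ((u ^ 2 - 1) * t) := by
  rw [commutatorElement_def, diag_conj_lo, ← lo_neg, ← lo_add, inv_inv]
  congr 1
  ring

lemma up_pow (t : R) (n : ℕ) : up t ^ n = up (n * t) := by
  induction n with
  | zero => simp [up_zero]
  | succ n ih => rw [pow_succ, ih, ← up_add]; congr 1; push_cast; ring

lemma lo_pow (t : R) (n : ℕ) : lo t ^ n = lo (n * t) := by
  induction n with
  | zero => simp [lo_zero]
  | succ n ih => rw [pow_succ, ih, ← lo_add]; congr 1; push_cast; ring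

lemma diag_pow (u : Rˣ) (n : ℕ) : diag u ^ n = diag (u ^ n) := by
  induction n with
  | zero => apply ext_entries <;> simp [diag_entry, one_entry]
  | succ n ih => rw [pow_succ, ih, ← diag_mul, pow_succ]

variable (R) in
/-- The subgroup generated by elementary matrices. -/
def elem : Subgroup (SpecialLinearGroup (Fin 2) R) :=
  Subgroup.closure (Set.range up ∪ Set.range lo)

lemma up_mem_elem (t : R) : up t ∈ elem R :=
  Subgroup.subset_closure (Or.inl ⟨t, rfl⟩)

lemma lo_mem_elem (t : R) : lo t ∈ elem R :=
  Subgroup.subset_closure (Or.inr ⟨t, rfl⟩)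

lemma wey_eq : (wey : SpecialLinearGroup (Fin 2) R) = up 1 * lo (-1) * up 1 := by
  apply ext_entries <;> simp [mul_entry, wey_entry, up_entry, lo_entry]

lemma wey_mem_elem : wey ∈ elem R := by
  rw [wey_eq]
  exact mul_mem (mul_mem (up_mem_elem _) (lo_mem_elem _)) (up_mem_elem _)

lemma mem_elem_of_isUnit (g : SpecialLinearGroup (Fin 2) R) (hg : IsUnit (g 1 0)) :
    g ∈ elem R := by
  obtain ⟨u, hu⟩ := hg
  have e : g = up ((g 0 0 - 1) * ↑u⁻¹) * lo (u : R) * up ((g 1 1 - 1) * ↑u⁻¹) := by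
    have hd := det_entries g
    have huu : (u : R) * ↑u⁻¹ = 1 := by simp
    rw [← hu] at hd
    apply ext_entries <;> simp [mul_entry, up_entry, lo_entry, ← hu]
    · linear_combination (-(↑u⁻¹ : R)) * hd + (-g 0 1) * huu
    · linear_combination (1 - g 1 1) * huu
  rw [e]
  exact mul_mem (mul_mem (up_mem_elem _) (lo_mem_elem _)) (up_mem_elem _)

lemma diag_mem_elem (u : Rˣ) : diag u ∈ elem R := by
  have := mul_mem (mem_elem_of_isUnit (diag u * wey) (by simp [mul_entry, diag_entry, wey_entry]))
    (inv_mem (wey_mem_elem (R := R)))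
  rwa [mul_inv_cancel_right] at this

end CommRing

lemma elem_eq_top_of_field (F : Type*) [Field F] : elem F = ⊤ := by
  rw [eq_top_iff]
  intro g _
  by_cases hc : g 1 0 = 0
  · have ha : g 0 0 ≠ 0 := by
      intro ha
      have := det_entries g
      simp [ha, hc] at this
    have := mul_mem (inv_mem (lo_mem_elem (1 : F))) (mem_elem_of_isUnit (lo 1 * g)
      (by simp [mul_entry, lo_entry, hc, ha]))
    rwa [inv_mul_cancel_left] at this
  · exact mem_elem_of_isUnit g (isUnit_iff_ne_zero.mpr hc)

end SLTwo

namespace RankOne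

namespace Relations

variable {F Q : Type*} [Field F] [Group Q] {X Y : F → Q} (H : Relations X Y)

local notation "w" => weyl X Y
local notation "h" => torus X Y

include H

/-- Over a finite field the torus elements multiply. -/
lemma torus_mul [Finite F] (u v : F) (hu : u ≠ 0) (hv : v ≠ 0) :
    h (u * v) = h u * h v := by
  by_cases su : IsSquare u
  · obtain ⟨r, rfl⟩ := su
    have hr : r ≠ 0 := left_ne_zero_of_mul hu
    rw [← pow_two, H.torus_sq_mul _ _ hr hv]
  by_cases sv : IsSquare v
  · obtain ⟨r, rfl⟩ := sv
    have hr : r ≠ 0 := left_ne_zero_of_mul hv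
    rw [← pow_two, mul_comm, H.torus_sq_mul _ _ hr hu, H.torus_comm _ _ (pow_ne_zero 2 hr) hu]
  have hsq : ∀ a b : F, ¬IsSquare a → ¬IsSquare b → IsSquare (a * b) := by
    classical
    have := Fintype.ofFinite F
    intro a b ha hb
    have ha0 : a ≠ 0 := fun e => ha (e ▸ ⟨0, by simp⟩)
    have hb0 : b ≠ 0 := fun e => hb (e ▸ ⟨0, by simp⟩)
    rw [← quadraticChar_one_iff_isSquare (mul_ne_zero ha0 hb0), map_mul,
      quadraticChar_neg_one_iff_not_isSquare.mpr ha, quadraticChar_neg_one_iff_not_isSquare.mpr hb]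
    norm_num
  obtain ⟨a, ha, ha1⟩ : ∃ a : F, ¬IsSquare a ∧ ¬IsSquare (1 - a) := by
    by_contra! hcon
    let N : Set F := {a | ¬IsSquare a}
    let P : Set F := {a | IsSquare a ∧ a ≠ 0}
    have h1 : N.ncard ≤ (P \ {1}).ncard := by
      refine Set.ncard_le_ncard_of_injOn (fun a => 1 - a) ?_ (fun a _ b _ e => sub_right_injective e)
        (Set.toFinite _)
      intro a ha
      refine ⟨⟨hcon a ha, fun e => ha ?_⟩, fun e => ha ?_⟩
      · rw [← sub_eq_zero.mp e]; exact ⟨1, by simp⟩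
      · rw [Set.mem_singleton_iff, sub_eq_self] at e
        rw [e]; exact ⟨0, by simp⟩
    have h2 : (P \ {1}).ncard < P.ncard :=
      Set.ncard_sdiff_singleton_lt_of_mem ⟨⟨1, by simp⟩, one_ne_zero⟩ (Set.toFinite _)
    have h3 : P.ncard ≤ N.ncard := by
      refine Set.ncard_le_ncard_of_injOn (fun a => u * a) ?_ (fun a _ b _ e => mul_left_cancel₀ hu e)
        (Set.toFinite _)
      rintro a ⟨⟨r, rfl⟩, hr⟩ ⟨s, hs⟩
      have hr0 : r ≠ 0 := left_ne_zero_of_mul hr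
      refine su ⟨s / r, ?_⟩
      field_simp
      linear_combination hs
    omega
  have ha0 : a ≠ 0 := fun e => ha (e ▸ ⟨0, by simp⟩)
  have hb0 : 1 - a ≠ 0 := fun e => ha1 (e ▸ ⟨0, by simp⟩)
  have hb : ¬IsSquare (1 - a)⁻¹ := fun e => ha1 (by simpa using e.inv)
  obtain ⟨s, hs⟩ := hsq u a su ha
  obtain ⟨t, ht⟩ := hsq v _ sv hb
  have hs0 : s / a ≠ 0 :=
    div_ne_zero (by rintro rfl; exact mul_ne_zero hu ha0 (by simpa using hs)) ha0
  have ht0 : t * (1 - a) ≠ 0 := mul_ne_zero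
    (by rintro rfl; exact mul_ne_zero hv (inv_ne_zero hb0) (by simpa using ht)) hb0
  have eu : u = (s / a) ^ 2 * a := by field_simp; linear_combination hs
  have ev : v = (t * (1 - a)) ^ 2 * (1 - a)⁻¹ := by
    field_simp at ht ⊢
    linear_combination ht
  have hab := H.torus_steinberg a ha0 hb0
  have huv : u * v = (s / a) ^ 2 * ((t * (1 - a)) ^ 2 * (a * (1 - a)⁻¹)) := by
    rw [eu, ev]; ring
  rw [huv, H.torus_sq_mul _ _ hs0
      (mul_ne_zero (pow_ne_zero 2 ht0) (mul_ne_zero ha0 (inv_ne_zero hb0))),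
    H.torus_sq_mul _ _ ht0 (mul_ne_zero ha0 (inv_ne_zero hb0)), ← hab]
  conv_rhs => rw [eu, ev, H.torus_sq_mul _ _ hs0 ha0, H.torus_sq_mul _ _ ht0 (inv_ne_zero hb0)]
  have hc := H.torus_comm a ((t * (1 - a)) ^ 2) ha0 (pow_ne_zero 2 ht0)
  simp only [← mul_assoc]
  rw [mul_assoc (h _) (h a), hc]
  simp only [← mul_assoc]

lemma Y_eq_torus (s : F) : Y s = X s⁻¹ * (h (-s⁻¹) * w 1) * X s⁻¹ := by
  rw [H.Y_eq, ← H.weyl_eq]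

section Bruhat

variable (hmul : ∀ u v : F, u ≠ 0 → v ≠ 0 → torus X Y (u * v) = torus X Y u * torus X Y v)

include hmul

lemma torus_inv (u : F) (hu : u ≠ 0) : h u⁻¹ = (h u)⁻¹ := by
  rw [eq_inv_iff_mul_eq_one, ← hmul _ _ (inv_ne_zero hu) hu, inv_mul_cancel₀ hu, H.torus_one]

lemma weyl_mul_torus (u : F) (hu : u ≠ 0) : w 1 * h u = h u⁻¹ * w 1 := by
  have e := H.torus_mul_weyl u 1 hu
  rw [mul_one, H.weyl_eq (u ^ 2), pow_two, hmul _ _ hu hu, mul_assoc, mul_assoc] at e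
  rw [H.torus_inv hmul u hu, eq_inv_mul_iff_mul_eq]
  exact (mul_left_cancel e).symm

lemma weyl_mul_weyl : w 1 * w 1 = h (-1) := by
  have e := H.weyl_eq (-1)
  have e2 := H.torus_inv hmul (-1) (by simp)
  rw [inv_neg, inv_one] at e2
  rw [H.weyl_neg, inv_eq_iff_eq_inv, mul_inv_rev, ← e2] at e
  nth_rw 2 [e]
  rw [mul_inv_cancel_left]

/-- The union of the two Bruhat cells is stable under multiplication by generators. -/
lemma exists_bruhat {z : Q} (hz : z ∈ Subgroup.closure (Set.range X ∪ Set.range Y)) :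
    (∃ u s, u ≠ 0 ∧ z = X s * h u) ∨ ∃ u s t, u ≠ 0 ∧ z = X s * h u * w 1 * X t := by
  let P : Q → Prop := fun z =>
    (∃ u s, u ≠ 0 ∧ z = X s * h u) ∨ ∃ u s t, u ≠ 0 ∧ z = X s * h u * w 1 * X t
  have hX : ∀ r z, P z → P (X r * z) := by
    rintro r z (⟨u, s, hu, rfl⟩ | ⟨u, s, t, hu, rfl⟩)
    · exact Or.inl ⟨u, r + s, hu, by rw [H.X_add, mul_assoc]⟩
    · exact Or.inr ⟨u, r + s, t, hu, by rw [H.X_add]; simp only [mul_assoc]⟩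
  have hT : ∀ v z, v ≠ 0 → P z → P (h v * z) := by
    rintro v z hv (⟨u, s, hu, rfl⟩ | ⟨u, s, t, hu, rfl⟩)
    · refine Or.inl ⟨v * u, v ^ 2 * s, mul_ne_zero hv hu, ?_⟩
      rw [hmul _ _ hv hu, ← mul_assoc, H.torus_mul_X _ _ hv, mul_assoc]
    · refine Or.inr ⟨v * u, v ^ 2 * s, t, mul_ne_zero hv hu, ?_⟩
      rw [hmul _ _ hv hu]
      simp only [← mul_assoc]
      rw [H.torus_mul_X _ _ hv]
  have hW0 : ∀ u t, u ≠ 0 → P (h u * w 1 * X t) := fun u t hu =>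
    Or.inr ⟨u, 0, t, hu, by rw [H.X_zero, one_mul]⟩
  have hW : ∀ z, P z → P (w 1 * z) := by
    rintro z (⟨u, s, hu, rfl⟩ | ⟨u, s, t, hu, rfl⟩)
    · have e : w 1 * (X s * h u) = h u⁻¹ * w 1 * X (u⁻¹ ^ 2 * s) := by
        have e1 := H.torus_mul_X u⁻¹ s (inv_ne_zero hu)
        rw [H.torus_inv hmul u hu] at e1
        have e2 : X s * h u = h u * X (u⁻¹ ^ 2 * s) := by
          rw [← inv_mul_eq_iff_eq_mul, ← mul_assoc, e1, inv_mul_cancel_right]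
        rw [e2, ← mul_assoc, H.weyl_mul_torus hmul u hu]
      rw [e]
      exact hW0 _ _ (inv_ne_zero hu)
    · have e1 : w 1 * (X s * h u * w 1 * X t) =
          Y (-s) * (h u⁻¹ * (h (-1) * X t)) := by
        simp only [← mul_assoc]
        rw [H.weyl_mul_X _ _ one_ne_zero, mul_assoc (Y _), H.weyl_mul_torus hmul u hu]
        simp only [mul_assoc]
        rw [← mul_assoc (w 1) (w 1), H.weyl_mul_weyl hmul]
        simp
      have e2 : P (h u⁻¹ * (h (-1) * X t)) :=
        hT _ _ (inv_ne_zero hu) (hT _ _ (by simp) (Or.inl ⟨1, t, one_ne_zero, by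
          rw [H.torus_one, mul_one]⟩))
      rw [e1]
      by_cases hs : s = 0
      · rwa [hs, neg_zero, H.Y_zero, one_mul]
      · rw [H.Y_eq_torus]
        have e3 : h u⁻¹ * (h (-1) * X t) = X (u⁻¹ ^ 2 * t) * h (-u⁻¹) := by
          rw [H.torus_mul_X _ _ (by simp), ← mul_assoc, H.torus_mul_X _ _ (inv_ne_zero hu),
            mul_assoc, ← hmul _ _ (inv_ne_zero hu) (by simp), mul_neg_one, neg_one_sq, one_mul]
        have hu' : -u⁻¹ ≠ 0 := neg_ne_zero.mpr (inv_ne_zero hu)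
        rw [e3]
        simp only [mul_assoc]
        refine hX _ _ (hT _ _ (by simpa using hs) ?_)
        rw [← mul_assoc (X _), ← H.X_add]
        have e4 : ∀ a, X a * h (-u⁻¹) = h (-u⁻¹) * X ((-u⁻¹)⁻¹ ^ 2 * a) := fun a => by
          rw [H.torus_mul_X _ _ hu']
          congr 2
          field_simp
        rw [e4, ← mul_assoc, H.weyl_mul_torus hmul _ hu']
        exact hW0 _ _ (inv_ne_zero hu')
  have hY : ∀ r z, P z → P (Y r * z) := by
    intro r z hz
    by_cases hr : r = 0
    · rwa [hr, H.Y_zero, one_mul]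
    · rw [H.Y_eq_torus r]
      simp only [mul_assoc]
      exact hX _ _ (hT _ _ (by simpa using hr) (hW _ (hX _ _ hz)))
  induction hz using Subgroup.closure_induction_left with
  | one => exact Or.inl ⟨1, 0, one_ne_zero, by rw [H.X_zero, H.torus_one, one_mul]⟩
  | mul_left x hx y hy ih =>
    obtain ⟨r, rfl⟩ | ⟨r, rfl⟩ := hx
    · exact hX r _ ih
    · exact hY r _ ih
  | inv_mul_cancel x hx y hy ih =>
    obtain ⟨r, rfl⟩ | ⟨r, rfl⟩ := hx
    · rw [← H.X_neg]; exact hX _ _ ih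
    · rw [← H.Y_neg]; exact hY _ _ ih

open SLTwo in
/-- A group generated by root elements satisfying the rank one relations, with multiplicative
torus, maps injectively to `SL₂`. -/
lemma eq_one_of_map_eq_one (π : Q →* Matrix.SpecialLinearGroup (Fin 2) F)
    (hX : ∀ t, π (X t) = up t) (hY : ∀ t, π (Y t) = lo t) {z : Q}
    (hz : z ∈ Subgroup.closure (Set.range X ∪ Set.range Y)) (h1 : π z = 1) : z = 1 := by
  have hw : ∀ u, π (w u) = up u * lo (-u⁻¹) * up u := fun u => by
    rw [weyl, map_mul, map_mul, hX, hY]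
  have hw1 : π (w 1) = wey := by rw [hw, inv_one, ← wey_eq]
  have ht : ∀ u (hu : u ≠ 0), π (h u) = diag (Units.mk0 u hu) := fun u hu => by
    rw [torus, map_mul, hw, hw]
    apply ext_entries <;> simp [mul_entry, up_entry, lo_entry, diag_entry, hu]
  obtain ⟨u, s, hu, rfl⟩ | ⟨u, s, t, hu, rfl⟩ := H.exists_bruhat hmul hz
  · rw [map_mul, hX, ht u hu] at h1
    have e0 : u = 1 := by
      simpa [mul_entry, up_entry, diag_entry, one_entry] using congrArg (fun g => g 0 0) h1
    subst e0
    have e1 : s = 0 := by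
      simpa [mul_entry, up_entry, diag_entry, one_entry] using congrArg (fun g => g 0 1) h1
    rw [e1, H.X_zero, H.torus_one, one_mul]
  · rw [map_mul, map_mul, map_mul, hX, hX, hw1, ht u hu] at h1
    have e0 := congrArg (fun g => g 1 0) h1
    simp [mul_entry, up_entry, diag_entry, one_entry, wey_entry, hu] at e0

end Bruhat

end Relations

end RankOne

section CentralExtension

open scoped commutatorElement

variable {Q G : Type*} [Group Q] [Group G] {π : Q →* G} (hπ : π.ker ≤ Subgroup.center Q)

include hπ

lemma exists_central_of_map_eq {a b : Q} (h : π a = π b) :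
    ∃ z, (∀ k, k * z = z * k) ∧ a = b * z := by
  refine ⟨b⁻¹ * a, Subgroup.mem_center_iff.mp (hπ ?_), by group⟩
  rw [MonoidHom.mem_ker, map_mul, map_inv, h, inv_mul_cancel]

lemma commutator_eq_of_map_eq {a b a' b' : Q} (ha : π a = π a') (hb : π b = π b') :
    ⁅a, b⁆ = ⁅a', b'⁆ := by
  obtain ⟨y, hy, rfl⟩ := exists_central_of_map_eq hπ ha
  obtain ⟨z, hz, rfl⟩ := exists_central_of_map_eq hπ hb
  have e1 : a' * y * (b' * z) = a' * b' * (y * z) := by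
    rw [mul_assoc, ← mul_assoc y, ← hy]; group
  have e2 : b' * z * (a' * y) = b' * a' * (y * z) := by
    rw [mul_assoc, ← mul_assoc z, ← hz, mul_assoc a', ← hy z]; group
  rw [commutatorElement_def, mul_assoc _ (a' * y)⁻¹, ← mul_inv_rev, e1, e2]
  group

lemma conj_eq_of_map_eq {a b : Q} (h : π a = π b) (k : Q) : a * k * a⁻¹ = b * k * b⁻¹ := by
  obtain ⟨z, hz, rfl⟩ := exists_central_of_map_eq hπ h
  rw [mul_inv_rev, mul_assoc b, ← hz]
  group

lemma conj_commutator_eq {e a b a' b' : Q} (ha : π e * π a * (π e)⁻¹ = π a')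
    (hb : π e * π b * (π e)⁻¹ = π b') : e * ⁅a, b⁆ * e⁻¹ = ⁅a', b'⁆ := by
  rw [conjugate_commutatorElement]
  exact commutator_eq_of_map_eq hπ (by simpa using ha) (by simpa using hb)

lemma commute_of_map_mem_zpowers {g : Q} {a b : Q} (ha : π a ∈ Subgroup.zpowers (π g))
    (hb : π b ∈ Subgroup.zpowers (π g)) : Commute a b := by
  obtain ⟨m, hm⟩ := ha
  obtain ⟨n, hn⟩ := hb
  rw [← commutatorElement_eq_one_iff_commute, commutator_eq_of_map_eq hπ (a' := g ^ m) (b' := g ^ n)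
    (by simpa using hm.symm) (by simpa using hn.symm), commutatorElement_eq_one_iff_commute]
  exact (Commute.refl g).zpow_zpow m n

end CentralExtension

section SchurMultiplier

open SLTwo RankOne
open scoped commutatorElement

variable {p : ℕ} [Fact p.Prime] {Q : Type*} [Group Q]

/-- The Schur multiplier of `SL₂(𝔽_p)` is trivial for `p ≥ 5`: a central extension of
`SL₂(𝔽_p)` is injective on its derived subgroup. -/
theorem SLTwo.eq_one_of_mem_commutator (hp : 5 ≤ p)
    (π : Q →* Matrix.SpecialLinearGroup (Fin 2) (ZMod p)) (hsurj : Function.Surjective π)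
    (hπ : π.ker ≤ Subgroup.center Q) {z : Q} (hz : z ∈ commutator Q) (h1 : π z = 1) : z = 1 := by
  have h2 : (2 : ZMod p) ≠ 0 := by
    intro h
    have : ((2 : ℕ) : ZMod p) = 0 := by exact_mod_cast h
    rw [ZMod.natCast_eq_zero_iff] at this
    exact absurd (Nat.le_of_dvd (by norm_num) this) (by omega)
  have h3 : (3 : ZMod p) ≠ 0 := by
    intro h
    have : ((3 : ℕ) : ZMod p) = 0 := by exact_mod_cast h
    rw [ZMod.natCast_eq_zero_iff] at this
    exact absurd (Nat.le_of_dvd (by norm_num) this) (by omega)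
  obtain ⟨l, hl⟩ := hsurj.hasRightInverse
  obtain ⟨d, hd⟩ : ∃ d : (ZMod p)ˣ, ∀ t : ZMod p, ((d : ZMod p) ^ 2 - 1) * (t / 3) = t := by
    refine ⟨Units.mk0 2 h2, fun t => ?_⟩
    rw [Units.val_mk0]
    field_simp
    ring
  let X : ZMod p → Q := fun t => ⁅l (diag d), l (up (t / 3))⁆
  let Y : ZMod p → Q := fun t => ⁅l (diag d⁻¹), l (lo (t / 3))⁆
  have hX : ∀ t, π (X t) = up t := fun t => by
    simp only [X, map_commutatorElement, hl _, commutator_diag_up, hd]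
  have hY : ∀ t, π (Y t) = lo t := fun t => by
    simp only [Y, map_commutatorElement, hl _, commutator_diag_lo, hd]
  have up_mem : ∀ t : ZMod p, up t ∈ Subgroup.zpowers (π (X 1)) := fun t => by
    refine ⟨(t.val : ℤ), ?_⟩
    dsimp only
    rw [hX, zpow_natCast, up_pow, ZMod.natCast_zmod_val, mul_one]
  have lo_mem : ∀ t : ZMod p, lo t ∈ Subgroup.zpowers (π (Y 1)) := fun t => by
    refine ⟨(t.val : ℤ), ?_⟩
    dsimp only
    rw [hY, zpow_natCast, lo_pow, ZMod.natCast_zmod_val, mul_one]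
  have hw : ∀ u (hu : u ≠ 0), π (weyl X Y u) = mk 0 u (-u⁻¹) 0 (by field_simp; ring) := by
    intro u hu
    rw [weyl, map_mul, map_mul, hX, hY]
    apply ext_entries <;> simp [mul_entry, up_entry, lo_entry, mk_entry, hu]
  have ht : ∀ u (hu : u ≠ 0), π (torus X Y u) = diag (Units.mk0 u hu) := fun u hu => by
    rw [torus, map_mul, hw u hu, hw (-1) (by simp)]
    apply ext_entries <;> simp [mul_entry, mk_entry, diag_entry]
  obtain ⟨g, hg⟩ := IsCyclic.exists_generator (α := (ZMod p)ˣ)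
  have H : Relations X Y := by
    constructor
    · intro s t
      have e : X (s + t) = ⁅l (diag d), l (up (s / 3)) * l (up (t / 3))⁆ :=
        commutator_eq_of_map_eq hπ rfl (by rw [map_mul, hl, hl, hl, ← up_add, add_div])
      have e2 : l (up (s / 3)) * X t = X t * l (up (s / 3)) :=
        commute_of_map_mem_zpowers hπ (g := X 1) (by rw [hl]; exact up_mem _)
          ((hX t).symm ▸ up_mem t)
      have e3 : ⁅l (diag d), l (up (s / 3)) * l (up (t / 3))⁆ =
          X s * (l (up (s / 3)) * X t * (l (up (s / 3)))⁻¹) := by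
        simp only [X, commutatorElement_def]; group
      rw [e, e3, e2, mul_inv_cancel_right]
    · intro s t
      have e : Y (s + t) = ⁅l (diag d⁻¹), l (lo (s / 3)) * l (lo (t / 3))⁆ :=
        commutator_eq_of_map_eq hπ rfl (by rw [map_mul, hl, hl, hl, ← lo_add, add_div])
      have e2 : l (lo (s / 3)) * Y t = Y t * l (lo (s / 3)) :=
        commute_of_map_mem_zpowers hπ (g := Y 1) (by rw [hl]; exact lo_mem _)
          ((hY t).symm ▸ lo_mem t)
      have e3 : ⁅l (diag d⁻¹), l (lo (s / 3)) * l (lo (t / 3))⁆ =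
          Y s * (l (lo (s / 3)) * Y t * (l (lo (s / 3)))⁻¹) := by
        simp only [Y, commutatorElement_def]; group
      rw [e, e3, e2, mul_inv_cancel_right]
    · intro u t hu
      apply conj_commutator_eq hπ
      · rw [hw u hu, hl, hl]
        apply ext_entries <;>
          simp only [mul_entry, mk_entry, diag_entry, inv_entry, inv_inv]
        · linear_combination ((d⁻¹ : (ZMod p)ˣ) : ZMod p) * mul_inv_cancel₀ hu
        · ring
        · ring
        · linear_combination (d : ZMod p) * mul_inv_cancel₀ hu
      · rw [hw u hu, hl, hl]
        apply ext_entries <;>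
          simp [mul_entry, mk_entry, up_entry, lo_entry, inv_entry, hu]
        field_simp
    · intro u t hu
      apply conj_commutator_eq hπ
      · rw [hw u hu, hl, hl]
        apply ext_entries <;>
          simp only [mul_entry, mk_entry, diag_entry, inv_entry, inv_inv]
        · linear_combination (d : ZMod p) * mul_inv_cancel₀ hu
        · ring
        · ring
        · linear_combination ((d⁻¹ : (ZMod p)ˣ) : ZMod p) * mul_inv_cancel₀ hu
      · rw [hw u hu, hl, hl]
        apply ext_entries <;>
          simp [mul_entry, mk_entry, up_entry, lo_entry, inv_entry, hu]
        field_simp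
    · intro u v hu hv
      have hz : ∀ u (hu : u ≠ 0), π (torus X Y u) ∈ Subgroup.zpowers (π (l (diag g))) :=
        fun u hu => by
          obtain ⟨n, hn⟩ := mem_powers_iff_mem_zpowers.mpr (hg (Units.mk0 u hu))
          refine ⟨(n : ℤ), ?_⟩
          simp only at hn
          simp [hl _, diag_pow, ht u hu, hn]
      exact commute_of_map_mem_zpowers hπ (hz u hu) (hz v hv)
  let Q₀ := Subgroup.closure (Set.range X ∪ Set.range Y)
  have hQ₀ : Q₀.map π = ⊤ := by
    rw [eq_top_iff, ← elem_eq_top_of_field, elem, Subgroup.closure_le]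
    rintro _ (⟨t, rfl⟩ | ⟨t, rfl⟩)
    · exact ⟨X t, Subgroup.subset_closure (Or.inl ⟨t, rfl⟩), hX t⟩
    · exact ⟨Y t, Subgroup.subset_closure (Or.inr ⟨t, rfl⟩), hY t⟩
  have hc : commutator Q ≤ Q₀ := by
    rw [commutator_def, Subgroup.commutator_le]
    intro a _ b _
    obtain ⟨a', ha', ha⟩ : π a ∈ Q₀.map π := hQ₀ ▸ Subgroup.mem_top _
    obtain ⟨b', hb', hb⟩ : π b ∈ Q₀.map π := hQ₀ ▸ Subgroup.mem_top _
    rw [commutator_eq_of_map_eq hπ ha.symm hb.symm, commutatorElement_def]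
    exact mul_mem (mul_mem (mul_mem ha' hb') (inv_mem ha')) (inv_mem hb')
  exact H.eq_one_of_map_eq_one (fun u v => H.torus_mul u v) π hX hY (hc hz) h1

end SchurMultiplier

namespace SLTwo

open Matrix
open scoped commutatorElement

variable {R : Type*} [CommRing R]

/-- The Euclidean algorithm: a matrix whose first column is integral is a product of elementary
matrices. -/
lemma mem_elem_of_intCast (n : ℕ) : ∀ (g : SpecialLinearGroup (Fin 2) R) (a c : ℤ),
    g 0 0 = a → g 1 0 = c → c.natAbs = n → g ∈ elem R := by
  induction n using Nat.strong_induction_on with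
  | _ n ih =>
    intro g a c ha hc hn
    by_cases hc0 : c = 0
    · subst hc0
      rw [Int.cast_zero] at hc
      have hu : IsUnit (g 0 0) := by
        have := det_entries g
        rw [hc, mul_zero, sub_zero] at this
        exact IsUnit.of_mul_eq_one _ this
      have := mul_mem (inv_mem (lo_mem_elem (1 : R))) (mem_elem_of_isUnit (lo 1 * g)
        (by simpa [mul_entry, lo_entry, hc] using hu))
      rwa [inv_mul_cancel_left] at this
    · have := mul_mem (up_mem_elem ((a / c : ℤ) : R)) (mul_mem (inv_mem (wey_mem_elem (R := R)))
        (ih (-(a % c)).natAbs ?_ (wey * (up (-((a / c : ℤ) : R)) * g)) c (-(a % c)) ?_ ?_ rfl))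
      · rwa [inv_mul_cancel_left, ← mul_assoc, ← up_add, add_neg_cancel, up_zero, one_mul] at this
      · have h1 := Int.emod_nonneg a hc0
        have h2 := Int.emod_lt_abs a hc0
        rw [Int.abs_eq_natAbs] at h2
        omega
      · simp [mul_entry, wey_entry, up_entry, hc]
      · simp only [mul_entry, wey_entry, up_entry, ha, hc]
        rw [Int.emod_def]
        push_cast
        ring

/-- If `2` and `3` are invertible, elementary matrices are commutators. -/
lemma elem_le_commutator (h2 : IsUnit (2 : R)) (h3 : IsUnit (3 : R)) :
    elem R ≤ commutator (SpecialLinearGroup (Fin 2) R) := by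
  obtain ⟨u, hu⟩ := h2
  obtain ⟨v, hv⟩ := h3
  have e : ∀ t : R, ((u : R) ^ 2 - 1) * (↑v⁻¹ * t) = t := fun t => by
    have : (u : R) ^ 2 - 1 = v := by rw [hu, hv]; norm_num
    rw [this, Units.mul_inv_cancel_left]
  rw [elem, Subgroup.closure_le]
  rintro _ (⟨t, rfl⟩ | ⟨t, rfl⟩)
  · rw [← e t, ← commutator_diag_up]
    exact Subgroup.commutator_mem_commutator (Subgroup.mem_top _) (Subgroup.mem_top _)
  · rw [← e t, ← commutator_diag_lo]
    exact Subgroup.commutator_mem_commutator (Subgroup.mem_top _) (Subgroup.mem_top _)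

end SLTwo

namespace ZS

open SLTwo

variable {S : Set ℕ}

lemma inv_natCast_mem {n : ℕ} (hn : n ≠ 0) (h : ∀ p : ℕ, p.Prime → p ∣ n → p ∈ S) :
    (n : ℚ)⁻¹ ∈ ZS S := by
  induction n using Nat.recOnMul with
  | zero => exact absurd rfl hn
  | one => simp [one_mem]
  | prime p hp => exact Subring.subset_closure ⟨p, h p hp dvd_rfl, rfl⟩
  | mul a b iha ihb =>
    rw [Nat.cast_mul, mul_inv]
    exact mul_mem
      (iha (left_ne_zero_of_mul hn) fun p hp hd => h p hp (hd.mul_right b))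
      (ihb (right_ne_zero_of_mul hn) fun p hp hd => h p hp (hd.mul_left a))

lemma isUnit_natCast {n : ℕ} (hn : n ≠ 0) (h : ∀ p : ℕ, p.Prime → p ∣ n → p ∈ S) :
    IsUnit (n : ZS S) :=
  IsUnit.of_mul_eq_one ⟨(n : ℚ)⁻¹, inv_natCast_mem hn h⟩
    (Subtype.ext (by simp [hn]))

lemma mul_den (a : ZS S) : a * ((a : ℚ).den : ZS S) = ((a : ℚ).num : ZS S) :=
  Subtype.ext (by simp)

variable (hS : ∀ p ∈ S, p.Prime)

include hS

lemma norm_le_one (p : ℕ) [Fact p.Prime] (hp : p ∉ S) {x : ℚ} (hx : x ∈ ZS S) :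
    ‖(x : ℚ_[p])‖ ≤ 1 := by
  have : ZS S ≤ (PadicInt.subring p).comap (Rat.castHom ℚ_[p]) := by
    rw [ZS, Subring.closure_le]
    rintro _ ⟨r, hr, rfl⟩
    have : ‖((r : ℚ_[p]))‖ = 1 := by
      rw [Padic.norm_natCast_eq_one_iff, Nat.coprime_primes Fact.out (hS r hr)]
      rintro rfl
      exact hp hr
    change ‖(((r : ℚ)⁻¹ : ℚ) : ℚ_[p])‖ ≤ 1
    rw [Rat.cast_inv, Rat.cast_natCast, norm_inv, this, inv_one]
  exact this hx

lemma den_mem {x : ℚ} (hx : x ∈ ZS S) (p : ℕ) (hp : p.Prime) (hd : p ∣ x.den) : p ∈ S := by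
  by_contra hpS
  have := Fact.mk hp
  have h1 := norm_le_one hS p hpS hx
  have h2 : ‖((x.den : ℕ) : ℚ_[p])‖ < 1 := Padic.norm_natCast_lt_one_iff.mpr hd
  have h3 : ‖((x.num : ℤ) : ℚ_[p])‖ = 1 := by
    rw [Padic.norm_intCast_eq_one_iff, Int.isCoprime_iff_gcd_eq_one]
    exact Nat.Coprime.coprime_dvd_right hd x.reduced
  have h4 : (x : ℚ_[p]) * (x.den : ℕ) = (x.num : ℤ) := by
    exact_mod_cast Rat.mul_den_eq_num x
  rw [← h4, norm_mul] at h3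
  nlinarith [norm_nonneg (x : ℚ_[p]), norm_nonneg ((x.den : ℕ) : ℚ_[p])]

/-- Reduction modulo a prime outside `S`. -/
noncomputable def toZMod (p : ℕ) [Fact p.Prime] (hp : p ∉ S) : ZS S →+* ZMod p :=
  PadicInt.toZMod.comp (((Rat.castHom ℚ_[p]).comp (ZS S).subtype).codRestrict (PadicInt.subring p)
    fun x => show _ ∈ PadicInt.subring p from norm_le_one hS p hp x.2)

lemma toZMod_eq_zero_iff (p : ℕ) [Fact p.Prime] (hp : p ∉ S) (a : ZS S) :
    toZMod hS p hp a = 0 ↔ ∃ b : ZS S, a = p * b := by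
  constructor
  · intro h
    have h2 : (((a : ℚ).num : ℤ) : ZMod p) = 0 := by
      rw [← map_intCast (toZMod hS p hp), ← mul_den, map_mul, h, zero_mul]
    obtain ⟨m, hm⟩ := (ZMod.intCast_zmod_eq_zero_iff_dvd _ _).mp h2
    refine ⟨⟨m * ((a : ℚ).den : ℚ)⁻¹, mul_mem (intCast_mem _ _)
      (inv_natCast_mem (a : ℚ).den_nz (den_mem hS a.2))⟩, Subtype.ext ?_⟩
    have h3 : ((a : ℚ).num : ℚ) = p * m := by rw [hm]; push_cast; rfl
    simp only [Subring.coe_mul, Subring.coe_natCast]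
    rw [← mul_assoc, ← h3, ← div_eq_mul_inv, Rat.num_div_den]
  · rintro ⟨b, rfl⟩
    simp

lemma toZMod_surjective (p : ℕ) [Fact p.Prime] (hp : p ∉ S) :
    Function.Surjective (toZMod hS p hp) :=
  ZMod.ringHom_surjective _

lemma prime_not_dvd_one (p : ℕ) [Fact p.Prime] (hp : p ∉ S) (b : ZS S) : (p : ZS S) * b ≠ 1 := by
  intro h
  have := congrArg (toZMod hS p hp) h
  simp at this

lemma mem_of_unit (hlam : ∃ lam : (ZS S)ˣ, IsUnit ((lam : ZS S) ^ 2 - 1)) (p : ℕ) [Fact p.Prime]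
    (h : ∀ x : (ZMod p)ˣ, (x : ZMod p) ^ 2 = 1) : p ∈ S := by
  by_contra hp
  obtain ⟨l, hl⟩ := hlam
  have h1 := hl.map (toZMod hS p hp)
  have h2 := h (Units.map (toZMod hS p hp).toMonoidHom l)
  simp only [Units.coe_map, RingHom.toMonoidHom_eq_coe, MonoidHom.coe_coe] at h2
  rw [map_sub, map_pow, map_one, h2, sub_self] at h1
  exact not_isUnit_zero h1

lemma two_mem (hlam : ∃ lam : (ZS S)ˣ, IsUnit ((lam : ZS S) ^ 2 - 1)) : 2 ∈ S :=
  mem_of_unit hS hlam 2 (by decide)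

lemma three_mem (hlam : ∃ lam : (ZS S)ˣ, IsUnit ((lam : ZS S) ^ 2 - 1)) : 3 ∈ S :=
  have h : ∀ x : (ZMod 3)ˣ, (x : ZMod 3) ^ 2 = 1 := by decide
  have : Fact (Nat.Prime 3) := ⟨Nat.prime_three⟩
  mem_of_unit hS hlam 3 h

omit hS in
lemma isUnit_of_mem {p : ℕ} (hp : p.Prime) (hpS : p ∈ S) : IsUnit (p : ZS S) :=
  isUnit_natCast hp.ne_zero fun r hr hd => by rwa [(Nat.prime_dvd_prime_iff_eq hr hp).mp hd]

lemma isUnit_den (a : ZS S) : IsUnit ((a : ℚ).den : ZS S) :=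
  isUnit_natCast (a : ℚ).den_nz (den_mem hS a.2)

lemma elem_eq_top : elem (ZS S) = ⊤ := by
  rw [eq_top_iff]
  intro g _
  obtain ⟨u, hu⟩ := (isUnit_den hS (g 0 0)).mul (isUnit_den hS (g 1 0))
  have := mul_mem (mem_elem_of_intCast _ (g * diag u)
    ((g 0 0 : ℚ).num * (g 1 0 : ℚ).den) ((g 1 0 : ℚ).num * (g 0 0 : ℚ).den)
    (by
      simp only [mul_entry, diag_entry, hu]
      push_cast
      rw [← mul_den (g 0 0)]
      ring)
    (by
      simp only [mul_entry, diag_entry, hu]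
      push_cast
      rw [← mul_den (g 1 0)]
      ring) rfl) (inv_mem (diag_mem_elem u))
  rwa [mul_inv_cancel_right] at this

lemma commutator_eq_top (h2 : 2 ∈ S) (h3 : 3 ∈ S) :
    commutator (Matrix.SpecialLinearGroup (Fin 2) (ZS S)) = ⊤ := by
  rw [eq_top_iff, ← elem_eq_top hS]
  exact elem_le_commutator (by exact_mod_cast isUnit_of_mem (S := S) Nat.prime_two h2)
    (by exact_mod_cast isUnit_of_mem (S := S) Nat.prime_three h3)

omit hS in
/-- Every natural number is a unit of `ℤ_S` times a number prime to `S`. -/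
lemma exists_unit_mul_natCast (n : ℕ) (hn : n ≠ 0) :
    ∃ (u : (ZS S)ˣ) (m : ℕ), m ≠ 0 ∧ (n : ZS S) = u * m ∧ ∀ p ∈ S, p.Prime → ¬p ∣ m := by
  induction n using Nat.recOnMul with
  | zero => exact absurd rfl hn
  | one => exact ⟨1, 1, one_ne_zero, by simp, fun p _ hp => hp.not_dvd_one⟩
  | prime p hp =>
    by_cases hpS : p ∈ S
    · obtain ⟨u, hu⟩ := isUnit_of_mem hp hpS
      exact ⟨u, 1, one_ne_zero, by simp [hu], fun p _ hp => hp.not_dvd_one⟩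
    · refine ⟨1, p, hn, by simp, fun r hr hrp hd => hpS ?_⟩
      rwa [← (Nat.prime_dvd_prime_iff_eq hrp hp).mp hd]
  | mul a b iha ihb =>
    obtain ⟨u, m, hm, e, h⟩ := iha (left_ne_zero_of_mul hn)
    obtain ⟨v, k, hk, f, h'⟩ := ihb (right_ne_zero_of_mul hn)
    refine ⟨u * v, m * k, mul_ne_zero hm hk, ?_, fun p hp hpp hd => ?_⟩
    · push_cast
      rw [e, f]
      ring
    · exact (hpp.dvd_mul.mp hd).elim (h p hp hpp) (h' p hp hpp)

/-- Every nonzero element of `ℤ_S` is a unit times a natural number prime to `S`. -/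
lemma exists_unit_mul (c : ZS S) (hc : c ≠ 0) :
    ∃ (u : (ZS S)ˣ) (m : ℕ), m ≠ 0 ∧ c = u * m ∧ ∀ p ∈ S, p.Prime → ¬p ∣ m := by
  have h := mul_den c
  obtain ⟨d, hd⟩ := isUnit_den hS c
  have hnum : (c : ℚ).num ≠ 0 := Rat.num_ne_zero.mpr fun e => hc (Subtype.ext e)
  obtain ⟨u, m, hm, e, h'⟩ := exists_unit_mul_natCast (S := S) _ (Int.natAbs_ne_zero.mpr hnum)
  rw [← hd, ← Units.eq_mul_inv_iff_mul_eq] at h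
  rcases Int.natAbs_eq (c : ℚ).num with hs | hs
  · refine ⟨u * d⁻¹, m, hm, ?_, h'⟩
    rw [h, hs, Int.cast_natCast, e]
    push_cast
    ring
  · refine ⟨-u * d⁻¹, m, hm, ?_, h'⟩
    rw [h, hs, Int.cast_neg, Int.cast_natCast, e]
    push_cast
    ring

lemma exists_intCast_congr (a : ZS S) (n : ℕ) (hn : ∀ p ∈ S, p.Prime → ¬p ∣ n) :
    ∃ (a₀ : ℤ) (b : ZS S), a = a₀ + n * b := by
  have hc : IsCoprime ((a : ℚ).den : ℤ) (n : ℤ) := by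
    rw [Nat.isCoprime_iff_coprime]
    refine Nat.coprime_of_dvd fun p hp hd hd' => hn p (den_mem hS a.2 p hp hd) hp hd'
  obtain ⟨x, y, hxy⟩ := hc
  refine ⟨(a : ℚ).num * x, y * a, ?_⟩
  have h : ((x * (a : ℚ).den + y * n : ℤ) : ZS S) = 1 := by rw [hxy, Int.cast_one]
  push_cast at h ⊢
  rw [← mul_den a]
  linear_combination (-a) * h

lemma coprime_of_congr {a c d e b : ZS S} {a₀ : ℤ} {n : ℕ} (hn : ∀ p ∈ S, p.Prime → ¬p ∣ n)
    (hu : a * d - e * (n * c) = 1) (ha : a = a₀ + n * b) : a₀.natAbs.Coprime n := by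
  refine Nat.coprime_of_dvd fun p hp hd hd' => ?_
  have := Fact.mk hp
  obtain ⟨k, rfl⟩ := hd'
  obtain ⟨l, rfl⟩ := Int.natCast_dvd.mpr hd
  refine prime_not_dvd_one hS p (fun h => hn p h hp (dvd_mul_right _ _))
    ((l + k * b) * d - e * (k * c)) ?_
  rw [← hu, ha]
  push_cast
  ring

end ZS

section Dirichlet

lemma exists_prime_congr_and_congr_neg_one (n m : ℕ) (hn : n ≠ 0) (hm : m ≠ 0)
    (hnm : n.Coprime m) (a : ℤ) (ha : IsCoprime a n) :
    ∃ p : ℕ, p.Prime ∧ 2 < p ∧ (n : ℤ) ∣ a - p ∧ (m : ℤ) ∣ p + 1 := by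
  obtain ⟨x, y, hxy⟩ := Nat.isCoprime_iff_coprime.mpr hnm
  have : NeZero (n * m) := ⟨mul_ne_zero hn hm⟩
  let b : ℤ := a - (a + 1) * (x * n)
  have hb : b = -1 + (a + 1) * (y * m) := by linear_combination (-(a + 1)) * hxy
  have hu : IsUnit ((b : ℤ) : ZMod (n * m)) := by
    rw [ZMod.coe_int_isUnit_iff_isCoprime, Nat.cast_mul]
    refine (IsCoprime.mul_right ?_ ?_).symm
    · have e : b = a + n * (-(a + 1) * x) := by simp only [b]; ring
      rw [e]
      exact ha.add_mul_left_left _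
    · have e : b = -1 + m * ((a + 1) * y) := by rw [hb]; ring
      rw [e]
      exact (isCoprime_one_left.neg_left).add_mul_left_left _
  obtain ⟨p, hp2, hp, hpb⟩ := Nat.forall_exists_prime_gt_and_eq_mod hu 2
  have h1 : ((n * m : ℕ) : ℤ) ∣ b - p := by
    rw [← ZMod.intCast_eq_intCast_iff_dvd_sub, Int.cast_natCast, hpb]
  rw [Nat.cast_mul] at h1
  refine ⟨p, hp, hp2, ?_, ?_⟩
  · have h2 := (Dvd.intro _ rfl).trans h1
    have e : a - p = (b - p) + n * ((a + 1) * x) := by simp only [b]; ring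
    rw [e]
    exact dvd_add h2 (Dvd.intro _ rfl)
  · have h2 := (Dvd.intro_left _ rfl).trans h1
    have e : (p : ℤ) + 1 = m * ((a + 1) * y) - (b - p) := by rw [hb]; ring
    rw [e]
    exact dvd_sub (Dvd.intro _ rfl) h2

/-- Up to sign, one finds primes `p` in a progression of odd modulus such that a given prime
does not divide `(p - 1) / 2`. -/
lemma exists_prime_congr_not_dvd (l n : ℕ) (hl : l.Prime) (hn : Odd n) (a : ℤ)
    (ha : IsCoprime a n) : ∃ (p j : ℕ) (e : ℤ), p.Prime ∧ p = 2 * j + 1 ∧ e * e = 1 ∧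
      (n : ℤ) ∣ a - e * p ∧ ¬l ∣ j := by
  have hn0 : n ≠ 0 := by rintro rfl; simp at hn
  have key : ∀ p : ℕ, p.Prime → 2 < p → ∃ j, p = 2 * j + 1 := fun p hp h2 =>
    hp.odd_of_ne_two (by omega)
  by_cases hl2 : l = 2
  · subst hl2
    obtain ⟨p, hp, hp2, h1, h2⟩ := exists_prime_congr_and_congr_neg_one n 4 hn0 (by norm_num)
      (by simpa using hn.coprime_two_right.pow_right 2) a ha
    obtain ⟨j, hj⟩ := key p hp hp2
    exact ⟨p, j, 1, hp, hj, by norm_num, by simpa using h1, by omega⟩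
  have hl3 : 2 < l := lt_of_le_of_ne hl.two_le (Ne.symm hl2)
  have key2 : ∀ p j : ℕ, p = 2 * j + 1 → (l : ℤ) ∣ p + 1 → ¬l ∣ j := by
    intro p j hj h1 h2
    have h3 : (l : ℤ) ∣ j := by exact_mod_cast h2
    have h4 : (l : ℤ) ∣ 2 := by
      have e : (2 : ℤ) = (p + 1) - 2 * j := by rw [hj]; push_cast; ring
      rw [e]
      exact dvd_sub h1 (h3.mul_left 2)
    have := Nat.le_of_dvd (by norm_num) (by exact_mod_cast h4 : l ∣ 2)
    omega
  by_cases hln : l ∣ n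
  · by_cases hal : (l : ℤ) ∣ a - 1
    · obtain ⟨p, hp, hp2, h1, -⟩ := exists_prime_congr_and_congr_neg_one n 1 hn0 (by norm_num)
        (by simp) (-a) ha.neg_left
      obtain ⟨j, hj⟩ := key p hp hp2
      refine ⟨p, j, -1, hp, hj, by norm_num, ?_, key2 p j hj ?_⟩
      · have e : a - -1 * p = -(-a - p) := by ring
        rw [e]
        exact dvd_neg.mpr h1
      · have h3 := (Int.natCast_dvd_natCast.mpr hln).trans h1
        have e : (p : ℤ) + 1 = -(-a - p) - (a - 1) := by ring
        rw [e]
        exact dvd_sub (dvd_neg.mpr h3) hal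
    · obtain ⟨p, hp, hp2, h1, -⟩ := exists_prime_congr_and_congr_neg_one n 1 hn0 (by norm_num)
        (by simp) a ha
      obtain ⟨j, hj⟩ := key p hp hp2
      refine ⟨p, j, 1, hp, hj, by norm_num, by simpa using h1, fun h2 => hal ?_⟩
      have h3 := (Int.natCast_dvd_natCast.mpr hln).trans h1
      have e : a - 1 = (a - p) + 2 * j := by rw [hj]; push_cast; ring
      rw [e]
      exact dvd_add h3 ((Int.natCast_dvd_natCast.mpr h2).mul_left 2)
  · obtain ⟨p, hp, hp2, h1, h2⟩ := exists_prime_congr_and_congr_neg_one n l hn0 hl.ne_zero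
      ((Nat.Prime.coprime_iff_not_dvd hl).mpr hln).symm a ha
    obtain ⟨j, hj⟩ := key p hp hp2
    exact ⟨p, j, 1, hp, hj, by norm_num, by simpa using h1, key2 p j hj h2⟩

end Dirichlet

namespace ZS

open SLTwo Matrix
open scoped commutatorElement

variable {S : Set ℕ} (hS : ∀ p ∈ S, p.Prime) (q : ℕ) [Fact q.Prime] (hq : q ∉ S)

/-- Reduction of `SL₂(ℤ_S)` modulo a prime outside `S`. -/
noncomputable def red : SpecialLinearGroup (Fin 2) (ZS S) →* SpecialLinearGroup (Fin 2) (ZMod q) :=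
  SpecialLinearGroup.map (toZMod hS q hq)

lemma red_entry (g : SpecialLinearGroup (Fin 2) (ZS S)) (i j : Fin 2) :
    red hS q hq g i j = toZMod hS q hq (g i j) := rfl

lemma red_up (t : ZS S) : red hS q hq (up t) = up (toZMod hS q hq t) := by
  apply ext_entries <;> simp [red_entry, up_entry]

lemma red_lo (t : ZS S) : red hS q hq (lo t) = lo (toZMod hS q hq t) := by
  apply ext_entries <;> simp [red_entry, lo_entry]

lemma red_surjective : Function.Surjective (red hS q hq) := by
  rw [← MonoidHom.range_eq_top, eq_top_iff, ← elem_eq_top_of_field, elem, Subgroup.closure_le]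
  rintro _ (⟨t, rfl⟩ | ⟨t, rfl⟩)
  · obtain ⟨s, rfl⟩ := toZMod_surjective hS q hq t
    exact ⟨up s, red_up hS q hq s⟩
  · obtain ⟨s, rfl⟩ := toZMod_surjective hS q hq t
    exact ⟨lo s, red_lo hS q hq s⟩

variable (S) in
/-- The normal subgroup generated by the elementary matrices congruent to `1` modulo `q`. -/
def elemCongr : Subgroup (SpecialLinearGroup (Fin 2) (ZS S)) :=
  Subgroup.normalClosure (Set.range fun t : ZS S => up (q * t))

instance : (elemCongr S q).Normal := Subgroup.normalClosure_normal

omit [Fact q.Prime] in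
lemma up_mem_elemCongr (t : ZS S) : up (q * t) ∈ elemCongr S q :=
  Subgroup.subset_normalClosure ⟨t, rfl⟩

omit [Fact q.Prime] in
lemma lo_mem_elemCongr (t : ZS S) : lo (q * t) ∈ elemCongr S q := by
  have := Subgroup.normalClosure_normal.conj_mem _ (up_mem_elemCongr q (-t)) wey
  rwa [wey_conj_up, mul_neg, neg_neg] at this

lemma elemCongr_le : elemCongr S q ≤ (red hS q hq).ker := by
  refine Subgroup.normalClosure_le_normal ?_
  rintro _ ⟨t, rfl⟩
  simp [MonoidHom.mem_ker, red_up, up_zero]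

/-- The quotient by the subgroup generated by congruent elementary matrices. -/
local notation "π" => QuotientGroup.mk' (elemCongr S q)

omit [Fact q.Prime] in
lemma mk_up_mul (t : ZS S) (g) : π (up (q * t) * g) = π g := by
  have h : π (up (q * t)) = 1 := (QuotientGroup.eq_one_iff _).mpr (up_mem_elemCongr q t)
  rw [map_mul, h, one_mul]

omit [Fact q.Prime] in
lemma mk_lo_mul (t : ZS S) (g) : π (lo (q * t) * g) = π g := by
  have h : π (lo (q * t)) = 1 := (QuotientGroup.eq_one_iff _).mpr (lo_mem_elemCongr q t)
  rw [map_mul, h, one_mul]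

omit [Fact q.Prime] in
lemma mk_mul_up (t : ZS S) (g) : π (g * up (q * t)) = π g := by
  have h : π (up (q * t)) = 1 := (QuotientGroup.eq_one_iff _).mpr (up_mem_elemCongr q t)
  rw [map_mul, h, mul_one]

lemma mk_eq_of_column {g k : SpecialLinearGroup (Fin 2) (ZS S)} (hg : g ∈ (red hS q hq).ker)
    (hk : k ∈ (red hS q hq).ker) (h0 : g 0 0 = k 0 0) (h1 : g 1 0 = k 1 0) : π g = π k := by
  have hr := mul_mem (inv_mem hk) hg
  have e : k⁻¹ * g = up ((k⁻¹ * g) 0 1) := by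
    have hk := det_entries k
    have hg := det_entries g
    apply ext_entries <;> simp only [mul_entry, inv_entry, up_entry, h0, h1]
    · linear_combination hk
    · ring
    · rw [h0, h1] at hg; linear_combination hg
  have h2 : toZMod hS q hq ((k⁻¹ * g) 0 1) = 0 := by
    rw [← red_entry, (MonoidHom.mem_ker).mp hr, one_entry.2.1]
  obtain ⟨t, ht⟩ := (toZMod_eq_zero_iff hS q hq _).mp h2
  rw [ht] at e
  rw [← mul_inv_cancel_left k g, e, mk_mul_up]

variable {d : (ZS S)ˣ} (hd : (d : ZS S) = 2)

include hd

/-- If the upper left entry is a prime `p = 2j + 1` up to sign, the `j`-th power of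
`diag(2, 1/2)` commutes with the class of the matrix. -/
lemma commute_of_prime {g : SpecialLinearGroup (Fin 2) (ZS S)} (hg : g ∈ (red hS q hq).ker)
    {p j : ℕ} {e : ℤ} (hp : p.Prime) (hpj : p = 2 * j + 1) (he : e * e = 1)
    (hge : g 0 0 = e * p) : Commute (π (diag d) ^ j) (π g) := by
  have h2p : IsCoprime (2 : ℤ) p := by
    rw [← Nat.cast_ofNat, Nat.isCoprime_iff_coprime, Nat.coprime_two_left, hpj]
    exact odd_two_mul_add_one j
  obtain ⟨k, hk⟩ := (Int.ModEq.pow_card_sub_one_eq_one hp h2p).symm.dvd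
  have hk' : ((d ^ j : (ZS S)ˣ) : ZS S) ^ 2 = 1 + p * k := by
    rw [Units.val_pow_eq_pow_val, hd, ← pow_mul, mul_comm j 2]
    have e1 : p - 1 = 2 * j := by omega
    rw [e1] at hk
    have := congrArg (Int.cast : ℤ → ZS S) hk
    push_cast at this
    linear_combination this
  obtain ⟨c, hc⟩ := (toZMod_eq_zero_iff hS q hq (g 1 0)).mp (by
    rw [← red_entry, (MonoidHom.mem_ker).mp hg, one_entry.2.2.1])
  rw [← map_pow, diag_pow]
  set v := d ^ j with hv
  have hvv : (v : ZS S) * ↑v⁻¹ = 1 := by simp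
  have he' : (e : ZS S) * e = 1 := by exact_mod_cast he
  have key : π (diag v * g * (diag v)⁻¹) = π (lo (q * (-e * c * (↑v⁻¹) ^ 2 * k)) * g) := by
    refine mk_eq_of_column hS q hq ?_ ?_ ?_ ?_
    · exact (MonoidHom.normal_ker _).conj_mem _ hg _
    · exact mul_mem (elemCongr_le hS q hq (lo_mem_elemCongr q _)) hg
    · simp only [mul_entry, diag_entry, inv_entry, lo_entry]
      linear_combination (g 0 0) * hvv
    · simp only [mul_entry, diag_entry, inv_entry, lo_entry, hge, hc]
      linear_combination (↑q * c * (↑v⁻¹) ^ 2 * p * k) * he' - (↑q * c * ((↑v⁻¹) ^ 2)) * hk' +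
        (q * c * (v * ↑v⁻¹ + 1)) * hvv
  rw [mk_lo_mul, map_mul, map_mul, map_inv, mul_inv_eq_iff_eq_mul] at key
  exact key

lemma exists_commute_pow (hS2 : 2 ∈ S) {g : SpecialLinearGroup (Fin 2) (ZS S)}
    (hg : g ∈ (red hS q hq).ker) (hc : g 1 0 ≠ 0) {l : ℕ} (hl : l.Prime) :
    ∃ j : ℕ, ¬l ∣ j ∧ Commute (π (diag d) ^ j) (π g) := by
  obtain ⟨u, n, hn, hcu, hnS⟩ := exists_unit_mul hS (g 1 0) hc
  have hqn : q ∣ n := by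
    have h : toZMod hS q hq (g 1 0) = 0 := by
      rw [← red_entry, (MonoidHom.mem_ker).mp hg, one_entry.2.2.1]
    rw [hcu, map_mul, mul_eq_zero, map_natCast, ZMod.natCast_eq_zero_iff] at h
    exact h.resolve_left (u.isUnit.map _).ne_zero
  have hqnS : ∀ p ∈ S, p.Prime → ¬p ∣ q * n := fun p hp hpp hd =>
    (hpp.dvd_mul.mp hd).elim (fun h => hnS p hp hpp (h.trans hqn)) (hnS p hp hpp)
  obtain ⟨a, b, hab⟩ := exists_intCast_congr hS (g 0 0) (q * n) hqnS
  have hcop : a.natAbs.Coprime n := by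
    refine coprime_of_congr hS (a := g 0 0) (d := g 1 1) (e := g 0 1 * u) (c := 1) (b := q * b)
      hnS ?_ ?_
    · have := det_entries g
      rw [hcu] at this
      linear_combination this
    · rw [hab]; push_cast; ring
  have hodd : Odd (q * n) := by
    rw [← Nat.not_even_iff_odd, even_iff_two_dvd]
    exact hqnS 2 hS2 Nat.prime_two
  obtain ⟨p, j, e, hp, hpj, he, ⟨m, hm⟩, hlj⟩ := exists_prime_congr_not_dvd l (q * n) hl hodd a (by
    rw [Int.isCoprime_iff_gcd_eq_one]
    exact Nat.Coprime.mul_right (hcop.coprime_dvd_right hqn) hcop)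
  refine ⟨j, hlj, ?_⟩
  have hm' : (a : ZS S) - e * p = q * n * m := by exact_mod_cast congrArg (Int.cast : ℤ → ZS S) hm
  have hu : (u : ZS S) * ↑u⁻¹ = 1 := by simp
  rw [← mk_up_mul q (-(((u⁻¹ : (ZS S)ˣ) : ZS S) * ((m : ZS S) + b))) g]
  refine commute_of_prime hS q hq hd
    (mul_mem (elemCongr_le hS q hq (up_mem_elemCongr q _)) hg) hp hpj he ?_
  simp only [mul_entry, up_entry, hcu]
  rw [hab]
  push_cast
  linear_combination hm' - (q * n * (m + b)) * hu

lemma commute_diag (hS2 : 2 ∈ S) {g : SpecialLinearGroup (Fin 2) (ZS S)}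
    (hg : g ∈ (red hS q hq).ker) : Commute (π (diag d)) (π g) := by
  wlog hc : g 1 0 ≠ 0 generalizing g
  · rw [not_not] at hc
    rw [← mk_lo_mul q 1 g]
    refine this (mul_mem (elemCongr_le hS q hq (lo_mem_elemCongr q _)) hg) ?_
    have ha : toZMod hS q hq (g 0 0) = 1 := by
      rw [← red_entry, (MonoidHom.mem_ker).mp hg, one_entry.1]
    have ha0 : g 0 0 ≠ 0 := by
      intro h
      rw [h, map_zero] at ha
      exact zero_ne_one ha
    simpa [mul_entry, lo_entry, hc] using ⟨(Fact.out : q.Prime).ne_zero, ha0⟩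
  let J : AddSubgroup ℤ := AddSubgroup.mk (AddSubmonoid.mk (AddSubsemigroup.mk
    {j : ℤ | Commute (π (diag d) ^ j) (π g)} (fun {a b} ha hb => by
      rw [Set.mem_ofPred_eq, _root_.zpow_add]; exact ha.mul_left hb)) (by simp)) (fun {a} ha => by
      rw [Set.mem_ofPred_eq, _root_.zpow_neg]; exact ha.inv_left)
  obtain ⟨m, hm⟩ := Int.subgroup_cyclic J
  have hm1 : m.natAbs = 1 := by
    by_contra h1
    obtain ⟨l, hl, hlm⟩ := Nat.exists_prime_and_dvd h1
    obtain ⟨j, hlj, hj⟩ := exists_commute_pow hS q hq hd hS2 hg hc hl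
    have : (j : ℤ) ∈ J := by
      change Commute (π (diag d) ^ (j : ℤ)) (π g)
      rwa [zpow_natCast]
    rw [hm, AddSubgroup.mem_closure_singleton] at this
    obtain ⟨k, hk⟩ := this
    apply hlj
    rw [← Int.natCast_dvd_natCast, ← hk, smul_eq_mul]
    exact (Int.natCast_dvd.mpr hlm).mul_left k
  have h1 : (1 : ℤ) ∈ J := by
    rw [hm, AddSubgroup.mem_closure_singleton]
    rcases Int.natAbs_eq m with h | h <;> rw [hm1] at h
    · exact ⟨1, by simp [h]⟩
    · exact ⟨-1, by simp [h]⟩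
  have : Commute (π (diag d) ^ (1 : ℤ)) (π g) := h1
  rwa [zpow_one] at this

end ZS

lemma map_mem_commutator {G G' : Type*} [Group G] [Group G'] (f : G →* G') {g : G}
    (hg : g ∈ commutator G) : f g ∈ commutator G' := by
  have h := Subgroup.mem_map_of_mem f hg
  rw [commutator_def, Subgroup.map_commutator] at h
  exact Subgroup.commutator_mono le_top le_top h

namespace ZS

open SLTwo Matrix
open scoped commutatorElement

variable {S : Set ℕ} (hS : ∀ p ∈ S, p.Prime) (q : ℕ) [Fact q.Prime] (hq : q ∉ S)

include hq in
lemma five_le (h2 : 2 ∈ S) (h3 : 3 ∈ S) : 5 ≤ q := by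
  have h : q ≠ 2 := fun h => hq (h ▸ h2)
  have h' : q ≠ 3 := fun h => hq (h ▸ h3)
  have hp : q.Prime := Fact.out
  have := hp.two_le
  have h4 : q ≠ 4 := fun h => by subst h; revert hp; decide
  omega

/-- Congruent elementary matrices normally generate the principal congruence subgroup. -/
theorem elemCongr_eq (h2 : 2 ∈ S) (h3 : 3 ∈ S) : elemCongr S q = (red hS q hq).ker := by
  obtain ⟨d, hd⟩ := isUnit_of_mem Nat.prime_two h2
  obtain ⟨w, hw⟩ := isUnit_of_mem Nat.prime_three h3
  have hdw : ∀ t : ZS S, ((d : ZS S) ^ 2 - 1) * (↑w⁻¹ * t) = t := fun t => by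
    have h : (w : ZS S) * ↑w⁻¹ = 1 := by simp
    rw [hw] at h
    rw [hd]
    push_cast at h ⊢
    linear_combination t * h
  set N := elemCongr S q with hN
  let π := QuotientGroup.mk' N
  have hπ : Function.Surjective π := QuotientGroup.mk'_surjective N
  have : ((red hS q hq).ker.map π).Normal := (MonoidHom.normal_ker _).map _ hπ
  let K := (Subgroup.centralizer ((red hS q hq).ker.map π : Set (_ ⧸ N))).comap π
  have hdK : ∀ u : (ZS S)ˣ, u = d ∨ u = d⁻¹ → diag u ∈ K := by
    have : diag d ∈ K := by
      rw [Subgroup.mem_comap, Subgroup.mem_centralizer_iff]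
      rintro _ ⟨g, hg, rfl⟩
      exact ((commute_diag hS q hq (by exact_mod_cast hd) h2 hg).eq).symm
    rintro u (rfl | rfl)
    · exact this
    · rw [diag_inv]; exact inv_mem this
  have hcomm : ∀ a ∈ K, ∀ b, ⁅a, b⁆ ∈ K := fun a ha b => by
    rw [commutatorElement_def, mul_assoc, mul_assoc]
    refine mul_mem ha ?_
    rw [← mul_assoc]
    exact (inferInstance : K.Normal).conj_mem _ (inv_mem ha) b
  have hK : K = ⊤ := by
    rw [eq_top_iff, ← elem_eq_top hS, elem, Subgroup.closure_le]
    rintro _ (⟨t, rfl⟩ | ⟨t, rfl⟩)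
    · rw [← hdw t, ← commutator_diag_up]
      exact hcomm _ (hdK d (Or.inl rfl)) _
    · rw [← hdw t, ← commutator_diag_lo]
      exact hcomm _ (hdK _ (Or.inr rfl)) _
  let ρ := QuotientGroup.lift N (red hS q hq) (elemCongr_le hS q hq)
  refine le_antisymm (elemCongr_le hS q hq) fun g hg => ?_
  rw [← QuotientGroup.eq_one_iff]
  refine SLTwo.eq_one_of_mem_commutator (five_le q hq h2 h3) ρ ?_ ?_ (z := π g) ?_ hg
  · intro y
    obtain ⟨x, rfl⟩ := red_surjective hS q hq y
    exact ⟨π x, rfl⟩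
  · intro x hx
    obtain ⟨x, rfl⟩ := hπ x
    rw [Subgroup.mem_center_iff]
    intro y
    obtain ⟨y, rfl⟩ := hπ y
    have hy : y ∈ K := hK ▸ Subgroup.mem_top y
    rw [Subgroup.mem_comap, Subgroup.mem_centralizer_iff] at hy
    exact (hy (π x) ⟨x, hx, rfl⟩).symm
  · have : g ∈ commutator (SpecialLinearGroup (Fin 2) (ZS S)) :=
      (commutator_eq_top hS h2 h3).symm ▸ Subgroup.mem_top g
    exact map_mem_commutator π this

end ZS

namespace SLTwo

open Matrix

/-- The subgroup of matrices whose lower left entry is divisible by `r`. -/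
def gammaZero {R : Type*} [CommRing R] (r : R) : Subgroup (SpecialLinearGroup (Fin 2) R) where
  carrier := {g | r ∣ g 1 0}
  one_mem' := by simp [one_entry]
  mul_mem' {a b} ha hb := by
    rw [Set.mem_ofPred_eq, mul_entry]
    exact dvd_add (ha.mul_right _) (hb.mul_left _)
  inv_mem' {a} ha := by
    rw [Set.mem_ofPred_eq, (inv_entry a).2.2.1]
    exact (dvd_neg).mpr ha

section

variable {R : Type*} [CommRing R] {r : R}

lemma mem_gammaZero {g : SpecialLinearGroup (Fin 2) R} : g ∈ gammaZero r ↔ r ∣ g 1 0 := Iff.rfl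

lemma up_mem_gammaZero (t : R) : up t ∈ gammaZero r := by simp [mem_gammaZero, up_entry]

lemma lo_mem_gammaZero (t : R) : lo (r * t) ∈ gammaZero r := by simp [mem_gammaZero, lo_entry]

lemma diag_mem_gammaZero (u : Rˣ) : diag u ∈ gammaZero r := by simp [mem_gammaZero, diag_entry]

end

end SLTwo

namespace ZS

open SLTwo Matrix
open scoped commutatorElement

variable {S : Set ℕ} (hS : ∀ p ∈ S, p.Prime) (q : ℕ) [Fact q.Prime] (hq : q ∉ S)

include hS hq in
lemma mem_gammaZero_iff {g : SpecialLinearGroup (Fin 2) (ZS S)} :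
    g ∈ gammaZero (q : ZS S) ↔ toZMod hS q hq (g 1 0) = 0 :=
  (toZMod_eq_zero_iff hS q hq _).symm

/-- The upper left entry modulo `q`, as a character of `Γ₀(q)`. -/
noncomputable def gammaZeroChar : gammaZero (q : ZS S) →* (ZMod q)ˣ :=
  MonoidHom.toHomUnits
    { toFun := fun g => toZMod hS q hq (g.1 0 0)
      map_one' := by simp
      map_mul' := fun g k => by
        rw [Subgroup.coe_mul, mul_entry, map_add, map_mul, map_mul,
          (mem_gammaZero_iff hS q hq).mp k.2, mul_zero, add_zero] }

lemma gammaZeroChar_coe (g : gammaZero (q : ZS S)) :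
    (gammaZeroChar hS q hq g : ZMod q) = toZMod hS q hq (g.1 0 0) := rfl

lemma gammaZeroChar_surjective : Function.Surjective (gammaZeroChar hS q hq) := by
  intro u
  obtain ⟨g, hg⟩ := red_surjective hS q hq (diag u)
  have h : g ∈ gammaZero (q : ZS S) := by
    rw [mem_gammaZero_iff hS q hq, ← red_entry, hg, (diag_entry u).2.2.1]
  refine ⟨⟨g, h⟩, Units.ext ?_⟩
  rw [gammaZeroChar_coe, ← red_entry, hg, (diag_entry u).1]

include hS hq in
/-- The Bruhat decomposition modulo `q`. -/
lemma exists_mem_gammaZero (g : SpecialLinearGroup (Fin 2) (ZS S)) :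
    ∃ γ ∈ gammaZero (q : ZS S), g = γ ∨ ∃ s, g = γ * (wey * up s) := by
  by_cases h : toZMod hS q hq (g 1 0) = 0
  · exact ⟨g, (mem_gammaZero_iff hS q hq).mpr h, Or.inl rfl⟩
  · obtain ⟨s, hs⟩ := toZMod_surjective hS q hq (toZMod hS q hq (g 1 1) / toZMod hS q hq (g 1 0))
    refine ⟨g * up (-s) * wey⁻¹, ?_, Or.inr ⟨s, ?_⟩⟩
    · rw [mem_gammaZero_iff hS q hq]
      simp [mul_entry, up_entry, inv_entry, wey_entry, hs, mul_div_cancel₀ _ h]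
    · rw [up_neg]; group

/-- A unit `d` of `ℤ_S` and the scaling `t ↦ t / (d² - 1)`. -/
lemma exists_unit_scale (h2 : 2 ∈ S) (h3 : 3 ∈ S) :
    ∃ (d : (ZS S)ˣ) (w : ZS S), ∀ t : ZS S, ((d : ZS S) ^ 2 - 1) * (t * w) = t := by
  obtain ⟨d, hd⟩ := isUnit_of_mem (S := S) Nat.prime_two h2
  obtain ⟨w, hw⟩ := isUnit_of_mem (S := S) Nat.prime_three h3
  refine ⟨d, ((w⁻¹ : (ZS S)ˣ) : ZS S), fun t => ?_⟩
  have h : (w : ZS S) * ↑w⁻¹ = 1 := by simp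
  rw [hw] at h
  rw [hd]
  push_cast at h ⊢
  linear_combination t * h

lemma gammaZeroChar_factor (h2 : 2 ∈ S) (h3 : 3 ∈ S) {M : Type*} [CommGroup M]
    (χ : gammaZero (q : ZS S) →* M) :
    ∃ Ψ : (ZMod q)ˣ →* M, ∀ g, χ g = Ψ (gammaZeroChar hS q hq g) := by
  obtain ⟨d, w, hdw⟩ := exists_unit_scale h2 h3
  have hcomm : ∀ x y : gammaZero (q : ZS S), χ ⁅x, y⁆ = 1 := fun x y => by
    rw [map_commutatorElement, commutatorElement_eq_one_iff_mul_comm, mul_comm]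
  have hup : ∀ t, χ ⟨up t, up_mem_gammaZero t⟩ = 1 := fun t => by
    rw [← hcomm ⟨diag d, diag_mem_gammaZero d⟩ ⟨up (t * w), up_mem_gammaZero _⟩]
    congr 1
    refine Subtype.ext ?_
    change up t = ⁅diag d, up (t * w)⁆
    rw [commutator_diag_up, hdw]
  have hlo : ∀ t, χ ⟨lo (q * t), lo_mem_gammaZero t⟩ = 1 := fun t => by
    rw [← hcomm ⟨diag d⁻¹, diag_mem_gammaZero d⁻¹⟩ ⟨lo (q * (t * w)), lo_mem_gammaZero _⟩]
    congr 1
    refine Subtype.ext ?_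
    change lo (q * t) = ⁅diag d⁻¹, lo (q * (t * w))⁆
    rw [commutator_diag_lo, ← mul_assoc (q : ZS S), hdw]
  have hconj : ∀ x y : gammaZero (q : ZS S), χ y = 1 → χ (x * y * x⁻¹) = 1 := fun x y h => by
    rw [map_mul, map_mul, h, mul_one, map_inv, mul_inv_cancel]
  have hN : (red hS q hq).ker ≤ χ.ker.map (gammaZero (q : ZS S)).subtype := by
    rw [← elemCongr_eq hS q hq h2 h3, elemCongr, Subgroup.normalClosure, Subgroup.closure_le]
    intro x hx
    obtain ⟨_, ⟨t, rfl⟩, hx⟩ := Group.mem_conjugatesOfSet_iff.mp hx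
    obtain ⟨g, rfl⟩ := isConj_iff.mp hx
    obtain ⟨γ, hγ, rfl | ⟨s, rfl⟩⟩ := exists_mem_gammaZero hS q hq g
    · exact ⟨_, hconj ⟨g, hγ⟩ _ (hup (q * t)), rfl⟩
    · refine ⟨_, hconj ⟨γ, hγ⟩ _ (hlo (-t)), ?_⟩
      change γ * lo (q * -t) * γ⁻¹ = _
      have e : up s * up (q * t) * (up s)⁻¹ = up (q * t) := by
        rw [← up_add, add_comm, up_add, mul_inv_cancel_right]
      rw [mul_neg, ← wey_conj_up, ← e]
      group
  have hker : (gammaZeroChar hS q hq).ker ≤ χ.ker := by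
    intro g hg
    have ha : toZMod hS q hq (g.1 0 0) = 1 := by
      rw [← gammaZeroChar_coe, MonoidHom.mem_ker.mp hg, Units.val_one]
    have hc := (mem_gammaZero_iff hS q hq).mp g.2
    have hd : toZMod hS q hq (g.1 1 1) = 1 := by
      have := congrArg (toZMod hS q hq) (det_entries g.1)
      simpa [ha, hc] using this
    have hr : up (-(g.1 0 1)) * g.1 ∈ (red hS q hq).ker := by
      rw [MonoidHom.mem_ker]
      apply ext_entries <;> simp [red_entry, mul_entry, up_entry, one_entry, ha, hc, hd]
    obtain ⟨k, hk, e⟩ := hN hr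
    have e' : g = ⟨up (g.1 0 1), up_mem_gammaZero _⟩ * k := by
      refine Subtype.ext ?_
      change g.1 = up (g.1 0 1) * (gammaZero (q : ZS S)).subtype k
      rw [e, up_neg, mul_inv_cancel_left]
    rw [MonoidHom.mem_ker, e', map_mul, hup, one_mul, hk]
  refine ⟨(gammaZeroChar hS q hq).liftOfSurjective (gammaZeroChar_surjective hS q hq) ⟨χ, hker⟩,
    fun g => ?_⟩
  exact ((gammaZeroChar hS q hq).liftOfRightInverse_comp_apply _ _ ⟨χ, hker⟩ g).symm

include hS hq in
/-- A central extension of `SL₂(ℤ_S)` that splits over `Γ₀(q)` splits. -/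
theorem exists_section (h2 : 2 ∈ S) (h3 : 3 ∈ S) {E : Type*} [Group E]
    (p : E →* SpecialLinearGroup (Fin 2) (ZS S)) (hp : Function.Surjective p)
    (hker : p.ker ≤ Subgroup.center E) (σ : gammaZero (q : ZS S) →* E)
    (hσ : ∀ g, p (σ g) = g) :
    ∃ s : SpecialLinearGroup (Fin 2) (ZS S) →* E, ∀ g, p (s g) = g := by
  obtain ⟨d, w, hdw⟩ := exists_unit_scale h2 h3
  let u : ZS S → gammaZero (q : ZS S) := fun t => ⟨up t, up_mem_gammaZero t⟩
  let K := Subgroup.normalClosure (Set.range fun t : ZS S => σ (u (q * t)))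
  have hKσ : K ≤ σ.range := by
    refine (Subgroup.closure_le _).mpr ?_
    intro x hx
    obtain ⟨_, ⟨t, rfl⟩, hx⟩ := Group.mem_conjugatesOfSet_iff.mp hx
    obtain ⟨e, rfl⟩ := isConj_iff.mp hx
    obtain ⟨γ, hγ, h | ⟨s, h⟩⟩ := exists_mem_gammaZero hS q hq (p e)
    · rw [conj_eq_of_map_eq hker (h.trans (hσ ⟨γ, hγ⟩).symm)]
      refine ⟨(⟨γ, hγ⟩ : gammaZero (q : ZS S)) * u (q * t) *
        (⟨γ, hγ⟩ : gammaZero (q : ZS S))⁻¹, ?_⟩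
      rw [map_mul, map_mul, map_inv]
    · obtain ⟨v, hv⟩ := hp wey
      rw [conj_eq_of_map_eq hker (b := σ ⟨γ, hγ⟩ * (v * σ (u s))) (by
        rw [h, map_mul, map_mul, hv, hσ, hσ])]
      have e1 : u s * u (q * t) * (u s)⁻¹ = u (q * t) := by
        refine Subtype.ext ?_
        change up s * up (q * t) * (up s)⁻¹ = up (q * t)
        rw [← up_add, add_comm, up_add, mul_inv_cancel_right]
      have e2 : u (q * t) = ⁅(⟨diag d, diag_mem_gammaZero d⟩ : gammaZero (q : ZS S)),
          u (q * t * w)⁆ := by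
        refine Subtype.ext ?_
        change up (q * t) = ⁅diag d, up (q * t * w)⁆
        rw [commutator_diag_up, hdw]
      have e3 : v * σ (u (q * t)) * v⁻¹ = ⁅σ ⟨diag d⁻¹, diag_mem_gammaZero _⟩,
          σ ⟨lo (q * (-t * w)), lo_mem_gammaZero _⟩⁆ := by
        rw [e2, map_commutatorElement]
        apply conj_commutator_eq hker
        · rw [hv, hσ, hσ, wey_conj_diag]
        · rw [hv, hσ, hσ, wey_conj_up]
          congr 1
          ring
      refine ⟨(⟨γ, hγ⟩ : gammaZero (q : ZS S)) *
          ⁅(⟨diag d⁻¹, diag_mem_gammaZero _⟩ : gammaZero (q : ZS S)),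
            ⟨lo (q * (-t * w)), lo_mem_gammaZero _⟩⁆ * (⟨γ, hγ⟩ : gammaZero (q : ZS S))⁻¹, ?_⟩
      rw [map_mul, map_mul, map_commutatorElement, ← e3, ← e1]
      simp only [map_mul, map_inv]
      group
  have hK1 : ∀ x ∈ K, p x = 1 → x = 1 := by
    intro x hx h
    obtain ⟨γ, rfl⟩ := hKσ hx
    rw [hσ] at h
    rw [show γ = 1 from Subtype.ext h, map_one]
  have hpK : K.map p = (red hS q hq).ker := by
    rw [← elemCongr_eq hS q hq h2 h3, elemCongr, Subgroup.map_normalClosure _ _ hp,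
      ← Set.range_comp]
    congr 2
    funext t
    exact hσ (u (q * t))
  let ρ : E ⧸ K →* SpecialLinearGroup (Fin 2) (ZMod q) :=
    QuotientGroup.lift K ((red hS q hq).comp p) fun x hx => by
      have : p x ∈ (red hS q hq).ker := hpK ▸ Subgroup.mem_map_of_mem p hx
      exact this
  have hinj : ∀ z ∈ commutator E, p z = 1 → z = 1 := by
    intro z hz h
    refine hK1 z ((QuotientGroup.eq_one_iff z).mp ?_) h
    refine SLTwo.eq_one_of_mem_commutator (five_le q hq h2 h3) ρ ?_ ?_
      (map_mem_commutator (QuotientGroup.mk' K) hz) ?_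
    · intro y
      obtain ⟨x, rfl⟩ := red_surjective hS q hq y
      obtain ⟨x, rfl⟩ := hp x
      exact ⟨QuotientGroup.mk' K x, rfl⟩
    · intro x hx
      obtain ⟨x, rfl⟩ := QuotientGroup.mk'_surjective K x
      have hx' : p x ∈ K.map p := hpK ▸ hx
      obtain ⟨k, hk, e⟩ := hx'
      obtain ⟨z, hz, rfl⟩ := exists_central_of_map_eq hker e.symm
      have hk1 : QuotientGroup.mk' K k = 1 := (QuotientGroup.eq_one_iff k).mpr hk
      rw [Subgroup.mem_center_iff]
      intro y
      obtain ⟨y, rfl⟩ := QuotientGroup.mk'_surjective K y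
      rw [map_mul, hk1, one_mul, ← map_mul, hz, map_mul]
    · change red hS q hq (p z) = 1
      rw [h, map_one]
  let p' := p.comp (commutator E).subtype
  have hp' : Function.Bijective p' := by
    constructor
    · rw [injective_iff_map_eq_one]
      exact fun z h => Subtype.ext (hinj z z.2 h)
    · intro g
      have hg : g ∈ (commutator E).map p := by
        rw [commutator_def, Subgroup.map_commutator, ← MonoidHom.range_eq_map,
          MonoidHom.range_eq_top.mpr hp, ← commutator_def, commutator_eq_top hS h2 h3]
        exact Subgroup.mem_top g
      obtain ⟨x, hx, rfl⟩ := hg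
      exact ⟨⟨x, hx⟩, rfl⟩
  let e := MulEquiv.ofBijective p' hp'
  exact ⟨(commutator E).subtype.comp e.symm.toMonoidHom, fun g => e.apply_symm_apply g⟩

end ZS

section PingPong

open Monoid Monoid.PushoutI

/-- A ping-pong criterion for amalgamated products of two groups: letters outside the amalgamated
subgroup exchange two disjoint regions and increase a height, which the amalgamated subgroup
preserves. -/
theorem mem_range_base_of_pingPong {A : Bool → Type*} {H G X : Type*} [∀ i, Group (A i)] [Group H]
    [Group G] [MulAction G X] {φ : ∀ i, H →* A i} (hφ : ∀ i, Function.Injective (φ i))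
    (f : PushoutI φ →* G) (R : Bool → X → Prop) (μ : Bool → X → ℝ)
    (hne : ∀ i, ∃ v, R i v) (hdisj : ∀ v, R false v → ¬R true v)
    (hletter : ∀ i, ∀ a ∉ (φ i).range, ∀ v, R i v →
      R (!i) (f (of i a) • v) ∧ μ i v < μ (!i) (f (of i a) • v))
    (hbase : ∀ i h v, R i v → R i (f (base φ h) • v) ∧ μ i v ≤ μ i (f (base φ h) • v))
    {x : PushoutI φ} (hx : f x = 1) : x ∈ (base φ).range := by
  classical
  obtain ⟨d⟩ := NormalWord.transversal_nonempty φ hφ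
  have key : ∀ w : NormalWord d, w.prod ∈ (base φ).range ∨ ∃ i, w.fstIdx = some i ∧ ∃ j, ∀ v,
      R j v → R (!i) (f w.prod • v) ∧ μ j v < μ (!i) (f w.prod • v) := by
    intro w
    induction w using NormalWord.consRecOn with
    | empty => exact Or.inl (by rw [NormalWord.prod_empty]; exact one_mem _)
    | cons i g w hmw _ hgr _ ih =>
      refine Or.inr ⟨i, rfl, ?_⟩
      rw [NormalWord.prod_cons]
      rcases ih with ⟨h, hh⟩ | ⟨i', hi', j, hj⟩
      · refine ⟨i, fun v hv => ?_⟩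
        rw [← hh, map_mul, mul_smul]
        obtain ⟨h1, h2⟩ := hbase i h v hv
        obtain ⟨h3, h4⟩ := hletter i g hgr _ h1
        exact ⟨h3, h2.trans_lt h4⟩
      · refine ⟨j, fun v hv => ?_⟩
        have hii : (!i') = i := by
          have : i' ≠ i := fun e => hmw (e ▸ hi')
          revert this
          cases i <;> cases i' <;> simp
        rw [map_mul, mul_smul]
        obtain ⟨h1, h2⟩ := hj v hv
        rw [hii] at h1 h2
        obtain ⟨h3, h4⟩ := hletter i g hgr _ h1
        exact ⟨h3, h2.trans h4⟩
    | base h w _ ih =>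
      rw [NormalWord.base_smul_eq_smul, NormalWord.prod_base_smul]
      rcases ih with hw | ⟨i, hi, j, hj⟩
      · exact Or.inl (mul_mem ⟨h, rfl⟩ hw)
      · refine Or.inr ⟨i, hi, j, fun v hv => ?_⟩
        obtain ⟨h1, h2⟩ := hj v hv
        rw [map_mul, mul_smul]
        obtain ⟨h3, h4⟩ := hbase _ h _ h1
        exact ⟨h3, h2.trans_le h4⟩
  obtain ⟨w, rfl⟩ := (NormalWord.equiv (d := d)).symm.surjective x
  change f w.prod = 1 at hx
  refine (key w).resolve_right ?_
  rintro ⟨i, _, j, hj⟩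
  obtain ⟨v, hv⟩ := hne j
  obtain ⟨h1, h2⟩ := hj v hv
  rw [hx, one_smul] at h1 h2
  have hij : (!i) = j := by
    cases i <;> cases j <;> simp only [Bool.not_false, Bool.not_true] at h1 ⊢
    · exact absurd h1 (hdisj v hv)
    · exact absurd hv (hdisj v h1)
  exact absurd h2 (by rw [hij]; exact lt_irrefl _)

end PingPong

section TwistedAmalgam

open Monoid Monoid.PushoutI

variable {A M : Type*} [Group A] [CommGroup M] {Γ : Subgroup A} (W : Γ →* Γ) (χ : Γ →* M)

/-- The two embeddings of `Γ × M` in `A × M`, the second one twisted by `W` and `χ`. -/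
def twist : ∀ _ : Bool, Γ × M →* A × M
  | false => Γ.subtype.prodMap (MonoidHom.id M)
  | true => ((Γ.subtype.comp W).comp (MonoidHom.fst Γ M)).prod
      (χ.comp (MonoidHom.fst Γ M) * MonoidHom.snd Γ M)

lemma twist_false (γ : Γ) (m : M) : twist W χ false (γ, m) = (γ.1, m) := rfl

lemma twist_true (γ : Γ) (m : M) : twist W χ true (γ, m) = ((W γ).1, χ γ * m) := rfl

lemma twist_injective (hW : Function.Injective W) (i : Bool) :
    Function.Injective (twist W χ i) := by
  rintro ⟨γ, m⟩ ⟨γ', m'⟩ h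
  cases i
  · rw [twist_false, twist_false, Prod.mk.injEq] at h
    exact Prod.ext (Subtype.ext h.1) h.2
  · rw [twist_true, twist_true, Prod.mk.injEq] at h
    obtain rfl := hW (Subtype.ext h.1)
    exact Prod.ext rfl (mul_left_cancel h.2)

/-- The amalgamated product of two copies of `A × M` along the two embeddings of `Γ × M`. -/
abbrev TwistedAmalgam := PushoutI (twist W χ)

namespace TwistedAmalgam

/-- The two copies of `A` in the amalgam. -/
def inj (i : Bool) : A →* TwistedAmalgam W χ :=
  (of (φ := twist W χ) i).comp (MonoidHom.inl A M)

/-- The central subgroup `M` of the amalgam. -/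
def cen : M →* TwistedAmalgam W χ := (base (twist W χ)).comp (MonoidHom.inr Γ M)

lemma inj_apply (i : Bool) (a : A) : inj W χ i a = of (φ := twist W χ) i (a, 1) := rfl

lemma cen_apply (m : M) : cen W χ m = base (twist W χ) (1, m) := rfl

lemma cen_eq_of (i : Bool) (m : M) : cen W χ m = of (φ := twist W χ) i (1, m) := by
  have h : twist W χ i (1, m) = (1, m) := by
    cases i
    · rw [twist_false, Subgroup.coe_one]
    · rw [twist_true, map_one, map_one, one_mul, Subgroup.coe_one]
  rw [cen_apply, ← of_apply_eq_base (twist W χ) i, h]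

lemma of_eq (i : Bool) (a : A) (m : M) :
    of (φ := twist W χ) i (a, m) = inj W χ i a * cen W χ m := by
  rw [cen_eq_of W χ i, inj_apply, ← map_mul, Prod.mk_mul_mk, mul_one, one_mul]

lemma cen_comm (m : M) (x : TwistedAmalgam W χ) : x * cen W χ m = cen W χ m * x := by
  have h : ∀ i a, inj W χ i a * cen W χ m = cen W χ m * inj W χ i a := fun i a => by
    rw [cen_eq_of W χ i, inj_apply, ← map_mul, ← map_mul, Prod.mk_mul_mk, Prod.mk_mul_mk, mul_one,
      one_mul, mul_one, one_mul]
  have h' : ∀ i a, of (φ := twist W χ) i a * cen W χ m = cen W χ m * of i a := fun i a => by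
    obtain ⟨a, m'⟩ := a
    rw [of_eq, mul_assoc, ← map_mul, mul_comm m' m, map_mul, ← mul_assoc, h, mul_assoc]
  induction x using PushoutI.induction_on with
  | of i g => exact h' i g
  | base g => rw [← of_apply_eq_base (twist W χ) false]; exact h' _ _
  | mul x y hx hy => rw [mul_assoc, hy, ← mul_assoc, hx, mul_assoc]

lemma base_eq (γ : Γ) (m : M) : base (twist W χ) (γ, m) = inj W χ false γ.1 * cen W χ m := by
  rw [← of_apply_eq_base (twist W χ) false, twist_false, of_eq]

lemma inj_false_eq (γ : Γ) :
    inj W χ false γ.1 = inj W χ true (W γ).1 * cen W χ (χ γ) := by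
  rw [← of_eq, ← mul_one (χ γ), ← twist_true, of_apply_eq_base (twist W χ) true, base_eq, map_one,
    mul_one]

/-- The universal property of the amalgam. -/
lemma exists_lift {K : Type*} [Group K] (s : Bool → A →* K) (ψ : M →* K)
    (hψ : ∀ i a m, s i a * ψ m = ψ m * s i a)
    (h : ∀ γ : Γ, s false γ.1 = s true (W γ).1 * ψ (χ γ)) :
    ∃ Θ : TwistedAmalgam W χ →* K, (∀ i a, Θ (inj W χ i a) = s i a) ∧
      ∀ m, Θ (cen W χ m) = ψ m := by
  let t : ∀ _ : Bool, A × M →* K := fun i =>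
    MonoidHom.noncommCoprod (s i) ψ (fun a m => hψ i a m)
  have ht : ∀ i a m, t i (a, m) = s i a * ψ m := fun i a m => rfl
  refine ⟨lift t ((t false).comp (twist W χ false)) ?_, fun i a => ?_, fun m => ?_⟩
  · rintro (_ | _)
    · rfl
    · ext1 ⟨γ, m⟩
      rw [MonoidHom.comp_apply, MonoidHom.comp_apply, twist_true, twist_false, ht, ht, h, map_mul,
        mul_assoc]
  · refine (lift_of _ _ _ _).trans ?_
    change t i (a, 1) = _
    rw [ht, map_one, mul_one]
  · refine (lift_base _ _ _ _).trans ?_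
    change t false (twist W χ false (1, m)) = _
    rw [twist_false, Subgroup.coe_one, ht, map_one, one_mul]

lemma hom_ext {K : Type*} [Group K] {f g : TwistedAmalgam W χ →* K}
    (h : ∀ i a, f (inj W χ i a) = g (inj W χ i a)) (h' : ∀ m, f (cen W χ m) = g (cen W χ m)) :
    f = g := by
  refine PushoutI.hom_ext_nonempty fun i => MonoidHom.ext fun a => ?_
  obtain ⟨a, m⟩ := a
  rw [MonoidHom.comp_apply, MonoidHom.comp_apply, of_eq, map_mul, map_mul, h, h']

lemma cen_injective (hW : Function.Injective W) : Function.Injective (cen W χ) :=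
  (base_injective (twist_injective W χ hW)).comp fun _ _ h => (Prod.mk.inj h).2

end TwistedAmalgam

end TwistedAmalgam

namespace SLTwo

open Matrix

section Flip

variable {R B : Type*} [CommRing R] [CommRing B] (j : R →+* B) (v : Bˣ)

/-- Conjugation by the matrix with antidiagonal entries `1` and `-v`. -/
def flip : SpecialLinearGroup (Fin 2) R →* SpecialLinearGroup (Fin 2) B where
  toFun g := mk (j (g 1 1)) (-(j (g 1 0) * ↑v⁻¹)) (-(v * j (g 0 1))) (j (g 0 0)) (by
    have h := congrArg j (det_entries g)
    have hv : (v : B) * ↑v⁻¹ = 1 := by simp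
    simp only [map_sub, map_mul, map_one] at h
    linear_combination h - j (g 0 1) * j (g 1 0) * hv)
  map_one' := by
    apply ext_entries <;> simp [mk_entry]
  map_mul' g k := by
    have hv : (v : B) * ↑v⁻¹ = 1 := by simp
    apply ext_entries <;> simp only [mul_entry, mk_entry, map_add, map_mul]
    · linear_combination -j (g 1 0) * j (k 0 1) * hv
    · ring
    · ring
    · linear_combination -j (g 0 1) * j (k 1 0) * hv

lemma flip_entry (g : SpecialLinearGroup (Fin 2) R) : flip j v g 0 0 = j (g 1 1) ∧
    flip j v g 0 1 = -(j (g 1 0) * ↑v⁻¹) ∧ flip j v g 1 0 = -(v * j (g 0 1)) ∧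
    flip j v g 1 1 = j (g 0 0) :=
  ⟨rfl, rfl, rfl, rfl⟩

lemma map_entries (g : SpecialLinearGroup (Fin 2) R) (k l : Fin 2) :
    SpecialLinearGroup.map j g k l = j (g k l) := rfl

variable [IsDomain R] {r : R} (hr : r ≠ 0)

omit [IsDomain R] in
/-- The lower left entry of an element of `Γ₀(r)`, divided by `r`. -/
noncomputable def lowerQuot (g : gammaZero r) : R := Exists.choose g.2

omit [IsDomain R] in
lemma lowerQuot_spec (g : gammaZero r) : g.1 1 0 = r * lowerQuot g := Exists.choose_spec g.2

include hr in
lemma lowerQuot_one : lowerQuot (1 : gammaZero r) = 0 := by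
  have h := lowerQuot_spec (1 : gammaZero r)
  have h1 : (1 : gammaZero r).1 1 0 = 0 := one_entry.2.2.1
  rw [h1] at h
  exact (mul_eq_zero.mp h.symm).resolve_left hr

include hr in
lemma lowerQuot_mul (g k : gammaZero r) :
    lowerQuot (g * k) = lowerQuot g * k.1 0 0 + g.1 1 1 * lowerQuot k := by
  refine mul_left_cancel₀ hr ?_
  rw [← lowerQuot_spec, Subgroup.coe_mul, mul_entry]
  linear_combination k.1 0 0 * lowerQuot_spec g + g.1 1 1 * lowerQuot_spec k

/-- The involution of `Γ₀(r)` induced by conjugation by the matrix with antidiagonal entries `1`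
and `-r`. -/
noncomputable def involution : gammaZero r →* gammaZero r where
  toFun g := ⟨mk (g.1 1 1) (-lowerQuot g) (-(r * g.1 0 1)) (g.1 0 0) (by
    have h := det_entries g.1
    rw [lowerQuot_spec] at h
    linear_combination h), ⟨-g.1 0 1, by rw [(mk_entry _ _ _ _ _).2.2.1, mul_neg]⟩⟩
  map_one' := by
    refine Subtype.ext ?_
    apply ext_entries <;> simp [mk_entry, lowerQuot_one hr]
  map_mul' g k := by
    refine Subtype.ext ?_
    apply ext_entries <;> simp only [mul_entry, mk_entry, Subgroup.coe_mul, lowerQuot_mul hr]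
    · linear_combination k.1 0 1 * lowerQuot_spec g
    · ring
    · ring
    · linear_combination g.1 0 1 * lowerQuot_spec k

lemma involution_entry (g : gammaZero r) : (involution hr g).1 0 0 = g.1 1 1 ∧
    r * (involution hr g).1 0 1 = -g.1 1 0 ∧ (involution hr g).1 1 0 = -(r * g.1 0 1) ∧
    (involution hr g).1 1 1 = g.1 0 0 :=
  ⟨rfl, by rw [lowerQuot_spec, ← mul_neg]; rfl, rfl, rfl⟩

lemma involution_involution (g : gammaZero r) : involution hr (involution hr g) = g := by
  obtain ⟨h00, h01, h10, h11⟩ := involution_entry hr g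
  obtain ⟨k00, k01, k10, k11⟩ := involution_entry hr (involution hr g)
  refine Subtype.ext (ext_entries ?_ ?_ ?_ ?_)
  · rw [k00, h11]
  · refine mul_left_cancel₀ hr ?_
    rw [k01, h10, neg_neg]
  · rw [k10, h01, neg_neg]
  · rw [k11, h00]

variable {v} (hv : (v : B) = j r)

include hv in
lemma flip_involution (g : gammaZero r) :
    flip j v (involution hr g).1 = SpecialLinearGroup.map j g.1 := by
  obtain ⟨h00, h01, h10, h11⟩ := involution_entry hr g
  obtain ⟨k00, k01, k10, k11⟩ := flip_entry j v (involution hr g).1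
  apply ext_entries
  · rw [k00, h11, map_entries]
  · rw [k01, h10, map_entries, map_neg, map_mul, ← hv, neg_mul, neg_neg, mul_right_comm,
      Units.mul_inv, one_mul]
  · rw [k10, hv, ← map_mul, h01, map_entries, map_neg, neg_neg]
  · rw [k11, h00, map_entries]

end Flip

section Ultrametric

variable {K : Type*} [NormedField K] [IsUltrametricDist K] {a b c d x y : K}

lemma norm_add_le_of_le {t : ℝ} (hx : ‖x‖ ≤ t) (hy : ‖y‖ ≤ t) : ‖x + y‖ ≤ t :=
  (IsUltrametricDist.norm_add_le_max x y).trans (max_le hx hy)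

lemma norm_add_lt_of_lt {t : ℝ} (hx : ‖x‖ < t) (hy : ‖y‖ < t) : ‖x + y‖ < t :=
  (IsUltrametricDist.norm_add_le_max x y).trans_lt (max_lt hx hy)

lemma norm_add_eq_left (h : ‖y‖ < ‖x‖) : ‖x + y‖ = ‖x‖ := by
  rw [IsUltrametricDist.norm_add_eq_max_of_norm_ne_norm h.ne', max_eq_left h.le]

omit [IsUltrametricDist K] in
lemma norm_mul_le_of_le_one {t : ℝ} (ha : ‖a‖ ≤ 1) (hx : ‖x‖ ≤ t) : ‖a * x‖ ≤ t := by
  rw [norm_mul]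
  exact (mul_le_of_le_one_left (norm_nonneg _) ha).trans hx

omit [IsUltrametricDist K] in
lemma norm_mul_eq_of_eq_one (ha : ‖a‖ = 1) : ‖a * x‖ = ‖x‖ := by
  rw [norm_mul, ha, one_mul]

/-- A lower left entry of norm one takes the region `|y| < |x|` to the region `|x| ≤ |y|`. -/
lemma norm_of_norm_lt (ha : ‖a‖ ≤ 1) (hb : ‖b‖ ≤ 1) (hc : ‖c‖ = 1) (hd : ‖d‖ ≤ 1)
    (h : ‖y‖ < ‖x‖) : ‖a * x + b * y‖ ≤ ‖c * x + d * y‖ ∧ ‖c * x + d * y‖ = ‖x‖ := by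
  have h2 : ‖c * x + d * y‖ = ‖x‖ := by
    rw [norm_add_eq_left, norm_mul_eq_of_eq_one hc]
    rw [norm_mul_eq_of_eq_one hc]
    exact (norm_mul_le_of_le_one hd le_rfl).trans_lt h
  rw [h2]
  exact ⟨norm_add_le_of_le (norm_mul_le_of_le_one ha le_rfl) (norm_mul_le_of_le_one hb h.le), rfl⟩

/-- An upper right entry of large norm takes the region `|x| ≤ |y|` to the region `|y| < |x|`. -/
lemma norm_of_norm_le (ha : ‖a‖ ≤ 1) (hb : 1 < ‖b‖) (hc : ‖c‖ ≤ 1) (hd : ‖d‖ ≤ 1)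
    (h : ‖x‖ ≤ ‖y‖) (hy : y ≠ 0) :
    ‖c * x + d * y‖ < ‖a * x + b * y‖ ∧ ‖a * x + b * y‖ = ‖b‖ * ‖y‖ := by
  have h1 : ‖y‖ < ‖b * y‖ := by
    rw [norm_mul]
    exact lt_mul_of_one_lt_left (norm_pos_iff.mpr hy) hb
  have h2 : ‖a * x + b * y‖ = ‖b * y‖ := by
    rw [add_comm, norm_add_eq_left]
    exact (norm_mul_le_of_le_one ha h).trans_lt h1
  rw [h2]
  refine ⟨?_, norm_mul _ _⟩
  exact (norm_add_le_of_le (norm_mul_le_of_le_one hc h) (norm_mul_le_of_le_one hd le_rfl)).trans_lt h1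

/-- A lower left entry of norm less than one preserves the region `|y| < |x|`. -/
lemma norm_of_norm_lt' (ha : ‖a‖ = 1) (hb : ‖b‖ ≤ 1) (hc : ‖c‖ < 1) (hd : ‖d‖ ≤ 1)
    (h : ‖y‖ < ‖x‖) : ‖c * x + d * y‖ < ‖a * x + b * y‖ ∧ ‖a * x + b * y‖ = ‖x‖ := by
  have h2 : ‖a * x + b * y‖ = ‖x‖ := by
    rw [norm_add_eq_left, norm_mul_eq_of_eq_one ha]
    rw [norm_mul_eq_of_eq_one ha]
    exact (norm_mul_le_of_le_one hb le_rfl).trans_lt h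
  rw [h2]
  refine ⟨norm_add_lt_of_lt ?_ ((norm_mul_le_of_le_one hd le_rfl).trans_lt h), rfl⟩
  rw [norm_mul]
  exact mul_lt_of_lt_one_left ((norm_nonneg _).trans_lt h) hc

/-- A lower left entry of norm less than one preserves the region `|x| ≤ |y|`. -/
lemma norm_of_norm_le' (ha : ‖a‖ ≤ 1) (hb : ‖b‖ ≤ 1) (hc : ‖c‖ < 1) (hd : ‖d‖ = 1)
    (h : ‖x‖ ≤ ‖y‖) (hy : y ≠ 0) :
    ‖a * x + b * y‖ ≤ ‖c * x + d * y‖ ∧ ‖c * x + d * y‖ = ‖y‖ := by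
  have h2 : ‖c * x + d * y‖ = ‖y‖ := by
    rw [add_comm, norm_add_eq_left, norm_mul_eq_of_eq_one hd]
    rw [norm_mul_eq_of_eq_one hd, norm_mul]
    refine (mul_le_mul_of_nonneg_left h (norm_nonneg _)).trans_lt ?_
    exact mul_lt_of_lt_one_left (norm_pos_iff.mpr hy) hc
  rw [h2]
  exact ⟨norm_add_le_of_le (norm_mul_le_of_le_one ha h) (norm_mul_le_of_le_one hb le_rfl), rfl⟩

/-- The diagonal entries of a matrix in `Γ₀` have norm one. -/
lemma norm_eq_one_of_det (ha : ‖a‖ ≤ 1) (hb : ‖b‖ ≤ 1) (hc : ‖c‖ < 1) (hd : ‖d‖ ≤ 1)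
    (h : a * d - b * c = 1) : ‖a‖ = 1 ∧ ‖d‖ = 1 := by
  have h1 : ‖a * d‖ = 1 := by
    rw [show a * d = 1 + b * c by linear_combination h, norm_add_eq_left, norm_one]
    rw [norm_one]
    exact (norm_mul_le_of_le_one hb le_rfl).trans_lt hc
  rw [norm_mul] at h1
  constructor <;> nlinarith [norm_nonneg a, norm_nonneg d]

end Ultrametric

end SLTwo

namespace ZS

open SLTwo Matrix Monoid.PushoutI TwistedAmalgam

variable {S : Set ℕ} (hS : ∀ p ∈ S, p.Prime) (q : ℕ) [hqp : Fact q.Prime] (hq : q ∉ S)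

variable (S) in
/-- The inclusion `ℤ_S ⊆ ℤ_{S ∪ {q}}`. -/
abbrev incl : ZS S →+* ZS (insert q S) :=
  Subring.inclusion (Subring.closure_mono (Set.image_mono (Set.subset_insert q S)))

variable (S) in
lemma exists_unit : ∃ v : (ZS (insert q S))ˣ, (v : ZS (insert q S)) = incl S q q := by
  obtain ⟨v, hv⟩ := isUnit_of_mem (S := insert q S) hqp.out (Set.mem_insert q S)
  exact ⟨v, by rw [hv, map_natCast]⟩

variable (S) in
/-- The prime `q` as a unit of `ℤ_{S ∪ {q}}`. -/
noncomputable def unitOf : (ZS (insert q S))ˣ := (exists_unit S q).choose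

lemma unitOf_eq : (unitOf S q : ZS (insert q S)) = incl S q q := (exists_unit S q).choose_spec

omit hqp in
lemma natCast_ne_zero (h : q ≠ 0) : (q : ZS S) ≠ 0 := by exact_mod_cast h

lemma prime_ne_zero : (q : ZS S) ≠ 0 := natCast_ne_zero q hqp.out.ne_zero

variable (S) in
/-- The embedding of `ℤ_S` in the `q`-adic numbers. -/
noncomputable def toPadic : ZS S →+* ℚ_[q] := (Rat.castHom ℚ_[q]).comp (ZS S).subtype

lemma toPadic_apply (x : ZS S) : toPadic S q x = ((x : ℚ) : ℚ_[q]) := by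
  unfold toPadic
  rw [RingHom.comp_apply, Subring.subtype_apply, eq_ratCast]

lemma toPadic_ne_zero {x : ZS S} (hx : x ≠ 0) : toPadic S q x ≠ 0 := by
  have hx' : (x : ℚ) ≠ 0 := fun h => hx (Subtype.ext h)
  rw [toPadic_apply]
  exact Rat.cast_ne_zero.mpr hx'

lemma toPadic_incl (x : ZS S) : toPadic (insert q S) q (incl S q x) = toPadic S q x := by
  have h : ((incl S q x : ZS (insert q S)) : ℚ) = x := Subring.coe_inclusion _ _
  rw [toPadic_apply, toPadic_apply, h]

include hS hq in
lemma norm_toPadic_le (x : ZS S) : ‖toPadic S q x‖ ≤ 1 := norm_le_one hS q hq x.2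

include hS hq in
lemma norm_toPadic_lt {x : ZS S} (h : (q : ZS S) ∣ x) : ‖toPadic S q x‖ < 1 := by
  obtain ⟨y, rfl⟩ := h
  rw [map_mul, norm_mul, map_natCast]
  exact (mul_le_of_le_one_right (norm_nonneg _) (norm_toPadic_le hS q hq y)).trans_lt
    Padic.norm_p_lt_one

include hS hq in
lemma norm_toPadic_eq {x : ZS S} (h : ¬(q : ZS S) ∣ x) : ‖toPadic S q x‖ = 1 := by
  refine le_antisymm (norm_toPadic_le hS q hq x) (not_lt.mp fun hlt => h ?_)
  refine (toZMod_eq_zero_iff hS q hq x).mp ?_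
  have h1 (z : ℤ_[q]) (hz : ‖z‖ < 1) : PadicInt.toZMod z = 0 := by
    rw [← RingHom.mem_ker, PadicInt.ker_toZMod, PadicInt.maximalIdeal_eq_span_p]
    exact Ideal.mem_span_singleton.mpr ((PadicInt.norm_lt_one_iff_dvd _).mp hz)
  exact h1 _ hlt

/-- The regions of the ping-pong argument, in terms of the first column. -/
def region (i : Bool) (g : SpecialLinearGroup (Fin 2) (ZS S)) : Prop :=
  match i with
  | false => ‖toPadic S q (g 1 0)‖ < ‖toPadic S q (g 0 0)‖
  | true => ‖toPadic S q (g 0 0)‖ ≤ ‖toPadic S q (g 1 0)‖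

lemma region_false (g : SpecialLinearGroup (Fin 2) (ZS S)) :
    region q false g ↔ ‖toPadic S q (g 1 0)‖ < ‖toPadic S q (g 0 0)‖ := Iff.rfl

lemma region_true (g : SpecialLinearGroup (Fin 2) (ZS S)) :
    region q true g ↔ ‖toPadic S q (g 0 0)‖ ≤ ‖toPadic S q (g 1 0)‖ := Iff.rfl

/-- The height of the ping-pong argument. -/
noncomputable def height (i : Bool) (g : SpecialLinearGroup (Fin 2) (ZS S)) : ℝ :=
  match i with
  | false => ‖toPadic S q (g 0 0)‖ ^ 2
  | true => q * ‖toPadic S q (g 1 0)‖ ^ 2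

lemma height_false (g : SpecialLinearGroup (Fin 2) (ZS S)) :
    height q false g = ‖toPadic S q (g 0 0)‖ ^ 2 := rfl

lemma height_true (g : SpecialLinearGroup (Fin 2) (ZS S)) :
    height q true g = q * ‖toPadic S q (g 1 0)‖ ^ 2 := rfl

lemma ne_zero_of_region {g : SpecialLinearGroup (Fin 2) (ZS S)} (h : region q true g) :
    toPadic S q (g 1 0) ≠ 0 := by
  refine toPadic_ne_zero q fun h0 => ?_
  have h' := (region_true q g).mp h
  have hd := det_entries g
  have hg : g 0 0 ≠ 0 := fun h1 => by simp [h0, h1] at hd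
  rw [h0, map_zero, norm_zero] at h'
  exact toPadic_ne_zero q hg (norm_le_zero_iff.mp h')

variable (k : SpecialLinearGroup (Fin 2) (ZS S)) (g : SpecialLinearGroup (Fin 2) (ZS (insert q S)))

lemma toPadic_map_mul (i l : Fin 2) :
    toPadic (insert q S) q ((SpecialLinearGroup.map (incl S q) k * g) i l) =
      toPadic S q (k i 0) * toPadic (insert q S) q (g 0 l) +
        toPadic S q (k i 1) * toPadic (insert q S) q (g 1 l) := by
  rw [mul_entry, map_add, map_mul, map_mul, map_entries, map_entries, toPadic_incl, toPadic_incl]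

lemma toPadic_flip_mul_zero : toPadic (insert q S) q ((flip (incl S q) (unitOf S q) k * g) 0 0) =
    toPadic S q (k 1 1) * toPadic (insert q S) q (g 0 0) +
      -(toPadic S q (k 1 0) * (q : ℚ_[q])⁻¹) * toPadic (insert q S) q (g 1 0) := by
  obtain ⟨k00, k01, -, -⟩ := flip_entry (incl S q) (unitOf S q) k
  rw [mul_entry, map_add, map_mul, map_mul, k00, k01, map_neg, map_mul, map_units_inv, unitOf_eq,
    toPadic_incl, toPadic_incl, toPadic_incl, map_natCast]

lemma toPadic_flip_mul_one : toPadic (insert q S) q ((flip (incl S q) (unitOf S q) k * g) 1 0) =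
    toPadic S q (-(q * k 0 1)) * toPadic (insert q S) q (g 0 0) +
      toPadic S q (k 0 0) * toPadic (insert q S) q (g 1 0) := by
  obtain ⟨-, -, k10, k11⟩ := flip_entry (incl S q) (unitOf S q) k
  rw [mul_entry, map_add, map_mul _ _ (g 0 0), map_mul _ _ (g 1 0), k10, k11, unitOf_eq,
    ← map_mul (incl S q), ← map_neg (incl S q), toPadic_incl, toPadic_incl]

include hS hq in
lemma region_map_mul (hk : k ∉ gammaZero (q : ZS S)) (h : region q false g) :
    region q true (SpecialLinearGroup.map (incl S q) k * g) ∧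
      height q false g < height q true (SpecialLinearGroup.map (incl S q) k * g) := by
  rw [region_false] at h
  obtain ⟨h1, h2⟩ := norm_of_norm_lt (norm_toPadic_le hS q hq (k 0 0))
    (norm_toPadic_le hS q hq (k 0 1)) (norm_toPadic_eq hS q hq hk)
    (norm_toPadic_le hS q hq (k 1 1)) h
  rw [region_true, height_false, height_true, toPadic_map_mul, toPadic_map_mul, h2]
  refine ⟨h1.trans_eq h2, ?_⟩
  have h0 : 0 < ‖toPadic (insert q S) q (g 0 0)‖ := (norm_nonneg _).trans_lt h
  exact lt_mul_of_one_lt_left (pow_pos h0 2) (by exact_mod_cast hqp.out.one_lt)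

include hS hq in
lemma region_flip_mul (hk : k ∉ gammaZero (q : ZS S)) (h : region q true g) :
    region q false (flip (incl S q) (unitOf S q) k * g) ∧
      height q true g < height q false (flip (incl S q) (unitOf S q) k * g) := by
  have hy := ne_zero_of_region q h
  rw [region_true] at h
  have hq1 : (1 : ℝ) < q := by exact_mod_cast hqp.out.one_lt
  have hb : ‖-(toPadic S q (k 1 0) * (q : ℚ_[q])⁻¹)‖ = q := by
    rw [norm_neg, norm_mul, norm_toPadic_eq hS q hq hk, norm_inv, Padic.norm_p, inv_inv, one_mul]
  obtain ⟨h1, h2⟩ := norm_of_norm_le (norm_toPadic_le hS q hq (k 1 1)) (hq1.trans_eq hb.symm)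
    (norm_toPadic_le hS q hq (-(q * k 0 1))) (norm_toPadic_le hS q hq (k 0 0)) h hy
  rw [region_false, height_false, height_true, toPadic_flip_mul_zero, toPadic_flip_mul_one]
  refine ⟨h1, ?_⟩
  rw [h2, hb]
  have h0 : 0 < ‖toPadic (insert q S) q (g 1 0)‖ := norm_pos_iff.mpr hy
  rw [mul_pow]
  exact mul_lt_mul_of_pos_right (lt_self_pow₀ hq1 one_lt_two) (pow_pos h0 2)

include hS hq in
lemma region_gammaZero_mul (hk : k ∈ gammaZero (q : ZS S)) (i : Bool) (h : region q i g) :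
    region q i (SpecialLinearGroup.map (incl S q) k * g) ∧
      height q i g ≤ height q i (SpecialLinearGroup.map (incl S q) k * g) := by
  have ha := norm_toPadic_le hS q hq (k 0 0)
  have hb := norm_toPadic_le hS q hq (k 0 1)
  have hc := norm_toPadic_lt hS q hq hk
  have hd := norm_toPadic_le hS q hq (k 1 1)
  have hdet := congrArg (toPadic S q) (det_entries k)
  rw [map_sub, map_mul, map_mul, map_one] at hdet
  obtain ⟨ha1, hd1⟩ := norm_eq_one_of_det ha hb hc hd hdet
  cases i
  · rw [region_false] at h
    obtain ⟨h1, h2⟩ := norm_of_norm_lt' ha1 hb hc hd h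
    rw [region_false, height_false, height_false, toPadic_map_mul, toPadic_map_mul]
    exact ⟨h1, by rw [h2]⟩
  · have h0 := ne_zero_of_region q h
    rw [region_true] at h
    obtain ⟨h1, h2⟩ := norm_of_norm_le' ha hb hc hd1 h h0
    rw [region_true, height_true, height_true, toPadic_map_mul, toPadic_map_mul]
    exact ⟨h1, by rw [h2]⟩

end ZS

namespace ZS

open SLTwo Matrix TwistedAmalgam

variable {S : Set ℕ} (hS : ∀ p ∈ S, p.Prime) (q : ℕ) [hqp : Fact q.Prime] (hq : q ∉ S)

lemma exists_pow_mul_mem {x : ℚ} (hx : x ∈ ZS (insert q S)) :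
    ∃ n : ℕ, ∀ k, x * q ^ (n + k) ∈ ZS S := by
  have hq0 : (q : ℚ) ≠ 0 := by exact_mod_cast hqp.out.ne_zero
  have hqm (n : ℕ) : (q : ℚ) ^ n ∈ ZS S := pow_mem (natCast_mem _ q) n
  induction hx using Subring.closure_induction with
  | mem x hx =>
    obtain ⟨p, rfl | hp, rfl⟩ := hx
    · refine ⟨1, fun k => ?_⟩
      simp only
      rw [pow_add, pow_one, inv_mul_cancel_left₀ hq0]
      exact hqm k
    · exact ⟨0, fun k => mul_mem (Subring.subset_closure ⟨p, hp, rfl⟩) (hqm _)⟩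
  | zero => exact ⟨0, fun k => by rw [zero_mul]; exact zero_mem _⟩
  | one => exact ⟨0, fun k => by rw [one_mul]; exact hqm _⟩
  | add x y _ _ hx hy =>
    obtain ⟨n, hn⟩ := hx
    obtain ⟨m, hm⟩ := hy
    refine ⟨n + m, fun k => ?_⟩
    rw [add_mul]
    refine add_mem ?_ ?_
    · rw [add_assoc]
      exact hn _
    · rw [add_comm n m, add_assoc]
      exact hm _
  | neg x _ hx =>
    obtain ⟨n, hn⟩ := hx
    exact ⟨n, fun k => by rw [neg_mul]; exact neg_mem (hn k)⟩
  | mul x y _ _ hx hy =>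
    obtain ⟨n, hn⟩ := hx
    obtain ⟨m, hm⟩ := hy
    refine ⟨n + m, fun k => ?_⟩
    rw [show x * y * (q : ℚ) ^ (n + m + k) = (x * q ^ (n + 0)) * (y * q ^ (m + k)) by ring]
    exact mul_mem (hn 0) (hm k)

include hS in
/-- `SL₂(ℤ_{S ∪ {q}})` is generated by two copies of `SL₂(ℤ_S)`. -/
lemma eq_top_of_map_mem (L : Subgroup (SpecialLinearGroup (Fin 2) (ZS (insert q S))))
    (h : ∀ g, SpecialLinearGroup.map (incl S q) g ∈ L)
    (h' : ∀ g, flip (incl S q) (unitOf S q) g ∈ L) : L = ⊤ := by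
  have hT : ∀ p ∈ insert q S, p.Prime := by
    rintro p (rfl | hp)
    · exact hqp.out
    · exact hS p hp
  have hw : (wey : SpecialLinearGroup (Fin 2) (ZS (insert q S))) ∈ L := by
    have e : SpecialLinearGroup.map (incl S q) wey = wey := by
      apply ext_entries <;> rw [map_entries] <;> simp [wey_entry]
    exact e ▸ h wey
  have hd : diag (unitOf S q)⁻¹ ∈ L := by
    have e : diag (unitOf S q)⁻¹ = flip (incl S q) (unitOf S q) wey * wey⁻¹ := by
      apply ext_entries <;> simp [mul_entry, flip_entry, wey_entry, inv_entry, diag_entry]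
    rw [e]
    exact mul_mem (h' _) (inv_mem hw)
  have hup (t : ZS (insert q S)) : up t ∈ L := by
    obtain ⟨n, hn⟩ := exists_pow_mul_mem q t.2
    have ht : t * (unitOf S q : ZS (insert q S)) ^ (2 * n) = incl S q ⟨_, hn n⟩ := by
      refine Subtype.ext ?_
      have h1 : ((incl S q ⟨_, hn n⟩ : ZS (insert q S)) : ℚ) = t * q ^ (n + n) :=
        Subring.coe_inclusion _ _
      rw [h1, unitOf_eq, map_natCast, Subring.coe_mul, Subring.coe_pow, Subring.coe_natCast,
        two_mul]
    have hmem : up (t * (unitOf S q : ZS (insert q S)) ^ (2 * n)) ∈ L := by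
      have e : SpecialLinearGroup.map (incl S q) (up ⟨_, hn n⟩) =
          up (t * (unitOf S q : ZS (insert q S)) ^ (2 * n)) := by
        rw [ht]
        apply ext_entries <;> rw [map_entries] <;> simp [up_entry]
      exact e ▸ h _
    have hd' := pow_mem hd n
    rw [diag_pow] at hd'
    have := mul_mem (mul_mem hd' hmem) (inv_mem hd')
    rw [diag_conj_up] at this
    convert this using 2
    rw [mul_left_comm, pow_mul', ← mul_pow, Units.val_pow_eq_pow_val, ← mul_pow, Units.inv_mul,
      one_pow, one_pow, mul_one]
  rw [eq_top_iff, ← elem_eq_top hT, elem, Subgroup.closure_le]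
  rintro _ (⟨t, rfl⟩ | ⟨t, rfl⟩)
  · exact hup t
  · have := mul_mem (mul_mem hw (hup (-t))) (inv_mem hw)
    rwa [wey_conj_up, neg_neg] at this

variable {M : Type*} [CommGroup M] (χ : gammaZero (q : ZS S) →* M)

include hS hq in
/-- The amalgam of two copies of `SL₂(ℤ_S) × M` along twisted embeddings of `Γ₀(q) × M` is an
extension of `SL₂(ℤ_{S ∪ {q}})` by `M`. -/
theorem exists_amalgam : ∃ π : TwistedAmalgam (involution (prime_ne_zero (S := S) q)) χ →*
      SpecialLinearGroup (Fin 2) (ZS (insert q S)),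
    (∀ a, π (inj _ χ false a) = SpecialLinearGroup.map (incl S q) a) ∧
    (∀ a, π (inj _ χ true a) = flip (incl S q) (unitOf S q) a) ∧
    Function.Surjective π ∧ π.ker = (cen (involution (prime_ne_zero (S := S) q)) χ).range := by
  have hr := prime_ne_zero (S := S) q
  have hinv := involution_involution hr
  have hW : Function.Injective (involution hr) := Function.LeftInverse.injective hinv
  obtain ⟨π, hπ, hπ'⟩ := exists_lift (involution hr) χ
    (fun i => Bool.rec (SpecialLinearGroup.map (incl S q)) (flip (incl S q) (unitOf S q)) i) 1
    (fun i a m => by rw [MonoidHom.one_apply, mul_one, one_mul])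
    (fun γ => by
      rw [MonoidHom.one_apply, mul_one]
      exact (flip_involution _ hr (unitOf_eq q) γ).symm)
  have hfalse (a) : π (inj _ χ false a) = SpecialLinearGroup.map (incl S q) a := hπ false a
  have htrue (a) : π (inj _ χ true a) = flip (incl S q) (unitOf S q) a := hπ true a
  have hcen (m : M) : π (cen (involution hr) χ m) = 1 := hπ' m
  refine ⟨π, hfalse, htrue, ?_, le_antisymm ?_ ?_⟩
  · rw [← MonoidHom.range_eq_top]
    exact eq_top_of_map_mem hS q _ (fun g => ⟨_, hfalse g⟩) fun g => ⟨_, htrue g⟩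
  · intro x hx
    have key : x ∈ (Monoid.PushoutI.base (twist (involution hr) χ)).range := by
      refine mem_range_base_of_pingPong (twist_injective _ χ hW) π
        (region (S := insert q S) q) (height q) ?_ ?_ ?_ ?_ (MonoidHom.mem_ker.mp hx)
      · rintro (_ | _)
        · exact ⟨1, by rw [region_false]; simp⟩
        · exact ⟨wey, by rw [region_true]; simp [wey_entry]⟩
      · intro v h h'
        rw [region_false] at h
        rw [region_true] at h'
        exact h'.not_gt h
      · rintro (_ | _) ⟨a, m⟩ ha v hv
        · have ha' : a ∉ gammaZero (q : ZS S) := fun h => ha ⟨(⟨a, h⟩, m), rfl⟩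
          rw [TwistedAmalgam.of_eq, map_mul, hcen, mul_one, hfalse, smul_eq_mul]
          exact region_map_mul hS q hq a v ha' hv
        · have ha' : a ∉ gammaZero (q : ZS S) := fun h => ha
            ⟨(involution hr ⟨a, h⟩, (χ (involution hr ⟨a, h⟩))⁻¹ * m), by
              rw [twist_true, hinv, mul_inv_cancel_left]⟩
          rw [TwistedAmalgam.of_eq, map_mul, hcen, mul_one, htrue, smul_eq_mul]
          exact region_flip_mul hS q hq a v ha' hv
      · rintro i ⟨γ, m⟩ v hv
        rw [base_eq, map_mul, hcen, mul_one, hfalse, smul_eq_mul]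
        exact region_gammaZero_mul hS q hq γ.1 v γ.2 i hv
    obtain ⟨⟨γ, m⟩, rfl⟩ := key
    rw [MonoidHom.mem_ker, base_eq, map_mul, hcen, mul_one, hfalse] at hx
    have hγ : γ.1 = 1 := by
      have hj : Function.Injective (incl S q) := Subring.inclusion_injective _
      have hx' (k l) : incl S q (γ.1 k l) =
          (1 : SpecialLinearGroup (Fin 2) (ZS (insert q S))) k l := by
        rw [← hx, map_entries]
      apply ext_entries <;> refine hj ((hx' _ _).trans ?_) <;> simp
    rw [base_eq, hγ, map_one, one_mul]
    exact ⟨m, rfl⟩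
  · rintro _ ⟨m, rfl⟩
    exact hcen m

end ZS

section Bar

variable {H N : Type*} [Group H] [AddCommGroup N]

lemma barD2_single (g k : H) : barD2 H (Finsupp.single (g, k) 1) =
    Finsupp.single k 1 - Finsupp.single (g * k) 1 + Finsupp.single g 1 := by
  simp [barD2]

lemma barD3_single (g h k : H) : barD3 H (Finsupp.single (g, h, k) 1) =
    Finsupp.single (h, k) 1 - Finsupp.single (g * h, k) 1 + Finsupp.single (g, h * k) 1 -
      Finsupp.single (g, h) 1 := by
  simp [barD3]

lemma barD2_barD3 (t : (H × H × H) →₀ ℤ) : barD2 H (barD3 H t) = 0 := by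
  have h : (barD2 H).comp (barD3 H) = 0 := by
    apply Finsupp.lhom_ext'
    rintro ⟨g, h, k⟩
    ext1
    simp only [LinearMap.comp_apply, Finsupp.lsingle_apply, barD3_single, map_sub, map_add,
      barD2_single, LinearMap.zero_apply, mul_assoc]
    abel
  exact LinearMap.congr_fun h t

/-- The boundary map onto the one-chains of a perfect group is surjective. -/
lemma barD2_surjective (hH : commutator H = ⊤) : Function.Surjective (barD2 H) := by
  rw [← LinearMap.range_eq_top]
  set P := LinearMap.range (barD2 H)
  let κ : H →* Multiplicative ((H →₀ ℤ) ⧸ P) := MonoidHom.mk'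
    (fun g => Multiplicative.ofAdd (P.mkQ (Finsupp.single g 1))) fun g k => by
      rw [← ofAdd_add, ← map_add]
      congr 1
      rw [← sub_eq_zero, ← map_sub, Submodule.mkQ_apply, Submodule.Quotient.mk_eq_zero]
      refine ⟨-Finsupp.single (g, k) 1, ?_⟩
      rw [map_neg, barD2_single]
      abel
  have hκ (g : H) : κ g = 1 := by
    have h : commutator H ≤ κ.ker := Abelianization.commutator_subset_ker κ
    rw [hH] at h
    exact h (Subgroup.mem_top g)
  rw [eq_top_iff]
  intro z _
  induction z using Finsupp.induction_linear with
  | zero => exact zero_mem _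
  | add x y hx hy => exact add_mem (hx trivial) (hy trivial)
  | single g n =>
    have h : P.mkQ (Finsupp.single g 1) = 0 := congrArg Multiplicative.toAdd (hκ g)
    rw [Submodule.mkQ_apply, Submodule.Quotient.mk_eq_zero] at h
    have := P.smul_mem n h
    rwa [Finsupp.smul_single, smul_eq_mul, mul_one] at this

/-- A two-cochain that vanishes on cycles of a perfect group is a coboundary. -/
lemma exists_cobounding (hH : commutator H = ⊤) (L : ((H × H) →₀ ℤ) →ₗ[ℤ] N)
    (hL : ∀ z, barD2 H z = 0 → L z = 0) :
    ∃ β : H → N, ∀ g k, L (Finsupp.single (g, k) 1) = β k - β (g * k) + β g := by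
  choose s hs using fun g : H => barD2_surjective hH (Finsupp.single g 1)
  refine ⟨fun g => L (s g), fun g k => ?_⟩
  rw [← map_sub, ← map_add, ← sub_eq_zero, ← map_sub]
  apply hL
  rw [map_sub, map_add, map_sub, hs, hs, hs, barD2_single, sub_self]

/-- A coboundary vanishes on cycles. -/
lemma eq_zero_of_cobounding (L : ((H × H) →₀ ℤ) →ₗ[ℤ] N) (β : H → N)
    (h : ∀ g k, L (Finsupp.single (g, k) 1) = β k - β (g * k) + β g) {z : (H × H) →₀ ℤ}
    (hz : barD2 H z = 0) : L z = 0 := by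
  have key : L = (Finsupp.linearCombination ℤ β).comp (barD2 H) := by
    apply Finsupp.lhom_ext'
    rintro ⟨g, k⟩
    ext1
    simp [h, barD2_single]
  rw [key, LinearMap.comp_apply, hz, map_zero]

lemma cocycle_of_comp_barD3 (L : ((H × H) →₀ ℤ) →ₗ[ℤ] N) (hL : ∀ t, L (barD3 H t) = 0)
    (g h k : H) : L (Finsupp.single (h, k) 1) + L (Finsupp.single (g, h * k) 1) =
      L (Finsupp.single (g, h) 1) + L (Finsupp.single (g * h, k) 1) := by
  have := hL (Finsupp.single (g, h, k) 1)
  rw [barD3_single, map_sub, map_add, map_sub] at this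
  rw [← sub_eq_zero, ← this]
  abel

lemma comp_barD3_of_cocycle (L : ((H × H) →₀ ℤ) →ₗ[ℤ] N)
    (hL : ∀ g h k, L (Finsupp.single (h, k) 1) + L (Finsupp.single (g, h * k) 1) =
      L (Finsupp.single (g, h) 1) + L (Finsupp.single (g * h, k) 1)) (t : (H × H × H) →₀ ℤ) :
    L (barD3 H t) = 0 := by
  have h : L.comp (barD3 H) = 0 := by
    apply Finsupp.lhom_ext'
    rintro ⟨g, h, k⟩
    ext1
    simp only [LinearMap.comp_apply, Finsupp.lsingle_apply, barD3_single, map_sub, map_add,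
      LinearMap.zero_apply]
    rw [sub_add_eq_add_sub, hL]
    abel
  exact LinearMap.congr_fun h t

/-- Two-cocycles that vanish on the image of `A` define homomorphisms on the cokernel of
`H₂(A) → H₂(H)`. -/
lemma exists_coker_hom {A : Type*} [Group A] (φ : A →* H) (L : ((H × H) →₀ ℤ) →ₗ[ℤ] N)
    (hL : ∀ t, L (barD3 H t) = 0) (hφ : ∀ z, barD2 A z = 0 → L (mapC2 φ z) = 0) :
    ∃ Φ : (H2 H ⧸ LinearMap.range (mapH2 φ)) →ₗ[ℤ] N, ∀ z : LinearMap.ker (barD2 H),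
      Φ (Submodule.Quotient.mk (Submodule.Quotient.mk z)) = L z := by
  refine ⟨Submodule.liftQ _ (Submodule.liftQ _ (L.comp (Submodule.subtype _)) ?_) ?_, fun z => rfl⟩
  · rintro ⟨_, hz⟩ ⟨t, rfl⟩
    exact hL t
  · rintro _ ⟨x, rfl⟩
    obtain ⟨z, rfl⟩ := Submodule.Quotient.mk_surjective _ x
    exact hφ z.1 z.2

/-- For a perfect group the projection of cycles to the cokernel of `H₂(A) → H₂(H)` extends to a
two-cocycle. -/
lemma exists_universal_cocycle {A : Type*} [Group A] (hH : commutator H = ⊤) (φ : A →* H) :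
    ∃ L : ((H × H) →₀ ℤ) →ₗ[ℤ] (H2 H ⧸ LinearMap.range (mapH2 φ)),
      (∀ z : LinearMap.ker (barD2 H),
        L z = Submodule.Quotient.mk (Submodule.Quotient.mk z)) ∧
      (∀ t, L (barD3 H t) = 0) ∧ ∀ z, barD2 A z = 0 → L (mapC2 φ z) = 0 := by
  obtain ⟨σ, hσ⟩ := Module.projective_lifting_property (barD2 H) LinearMap.id
    (barD2_surjective hH)
  have hσ' (z) : barD2 H (σ z) = z := LinearMap.congr_fun hσ z
  let P : ((H × H) →₀ ℤ) →ₗ[ℤ] LinearMap.ker (barD2 H) :=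
    (LinearMap.id - σ.comp (barD2 H)).codRestrict _ fun z => by
      simp [hσ']
  have hP (z : LinearMap.ker (barD2 H)) : P z = z := by
    refine Subtype.ext ?_
    simp [P, LinearMap.mem_ker.mp z.2]
  let L := (Submodule.mkQ (LinearMap.range (mapH2 φ))).comp ((Submodule.mkQ _).comp P)
  have hL (z : LinearMap.ker (barD2 H)) :
      L z = Submodule.Quotient.mk (Submodule.Quotient.mk z) := by
    simp only [L, LinearMap.comp_apply, hP, Submodule.mkQ_apply]
  refine ⟨L, hL, fun t => ?_, fun z hz => ?_⟩
  · refine (hL ⟨_, LinearMap.mem_ker.mpr (barD2_barD3 t)⟩).trans ?_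
    have h : (Submodule.Quotient.mk ⟨_, LinearMap.mem_ker.mpr (barD2_barD3 t)⟩ : H2 H) = 0 :=
      (Submodule.Quotient.mk_eq_zero _).mpr ⟨t, rfl⟩
    rw [h, Submodule.Quotient.mk_zero]
  · have hz' : barD2 H (mapC2 φ z) = 0 := by
      have := LinearMap.congr_fun (barD2_comm φ) z
      rw [LinearMap.comp_apply, LinearMap.comp_apply, hz, map_zero] at this
      exact this
    refine (hL ⟨_, LinearMap.mem_ker.mpr hz'⟩).trans ?_
    exact (Submodule.Quotient.mk_eq_zero _).mpr
      ⟨Submodule.Quotient.mk ⟨z, LinearMap.mem_ker.mpr hz⟩, rfl⟩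

end Bar

section CocycleExt

variable {H N : Type*} [Group H] [AddCommGroup N]

/-- The central extension of a group attached to a two-cocycle. -/
@[ext]
structure CocycleExt (L : ((H × H) →₀ ℤ) →ₗ[ℤ] N) (_ : ∀ t, L (barD3 H t) = 0) where
  /-- The central component. -/
  fst : N
  /-- The component in the group which is extended. -/
  snd : H

namespace CocycleExt

variable {L : ((H × H) →₀ ℤ) →ₗ[ℤ] N} {hL : ∀ t, L (barD3 H t) = 0}

lemma cocycle_one_left (hL : ∀ t, L (barD3 H t) = 0) (g : H) :
    L (Finsupp.single (1, g) 1) = L (Finsupp.single (1, 1) 1) := by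
  have := cocycle_of_comp_barD3 L hL 1 1 g
  rwa [one_mul, one_mul, add_right_cancel_iff] at this

lemma cocycle_one_right (hL : ∀ t, L (barD3 H t) = 0) (g : H) :
    L (Finsupp.single (g, 1) 1) = L (Finsupp.single (1, 1) 1) := by
  have := cocycle_of_comp_barD3 L hL g 1 1
  rw [one_mul, mul_one, add_right_cancel_iff] at this
  exact this.symm

noncomputable instance : Mul (CocycleExt L hL) :=
  ⟨fun x y => ⟨x.fst + y.fst + L (Finsupp.single (x.snd, y.snd) 1), x.snd * y.snd⟩⟩

noncomputable instance : One (CocycleExt L hL) := ⟨⟨-L (Finsupp.single (1, 1) 1), 1⟩⟩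

noncomputable instance : Inv (CocycleExt L hL) :=
  ⟨fun x =>
    ⟨-x.fst - L (Finsupp.single (x.snd⁻¹, x.snd) 1) - L (Finsupp.single (1, 1) 1), x.snd⁻¹⟩⟩

lemma mul_fst (x y : CocycleExt L hL) :
    (x * y).fst = x.fst + y.fst + L (Finsupp.single (x.snd, y.snd) 1) := rfl

lemma mul_snd (x y : CocycleExt L hL) : (x * y).snd = x.snd * y.snd := rfl

lemma one_fst : (1 : CocycleExt L hL).fst = -L (Finsupp.single (1, 1) 1) := rfl

lemma one_snd : (1 : CocycleExt L hL).snd = 1 := rfl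

lemma inv_fst (x : CocycleExt L hL) :
    (x⁻¹).fst = -x.fst - L (Finsupp.single (x.snd⁻¹, x.snd) 1) - L (Finsupp.single (1, 1) 1) := rfl

lemma inv_snd (x : CocycleExt L hL) : (x⁻¹).snd = x.snd⁻¹ := rfl

noncomputable instance : Group (CocycleExt L hL) := Group.ofLeftAxioms
  (fun x y z => by
    refine CocycleExt.ext ?_ ?_
    · rw [mul_fst, mul_fst, mul_fst, mul_fst, mul_snd, mul_snd]
      have := cocycle_of_comp_barD3 L hL x.snd y.snd z.snd
      rw [add_right_comm _ (L _) z.fst, add_assoc _ (L _) (L _), ← this]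
      abel
    · rw [mul_snd, mul_snd, mul_snd, mul_snd, mul_assoc])
  (fun x => by
    refine CocycleExt.ext ?_ ?_
    · rw [mul_fst, one_fst, one_snd, cocycle_one_left hL x.snd, neg_add_cancel_comm]
    · rw [mul_snd, one_snd, one_mul])
  (fun x => by
    refine CocycleExt.ext ?_ ?_
    · rw [mul_fst, one_fst, inv_fst, inv_snd]
      generalize L _ = a, L _ = b
      abel
    · rw [mul_snd, one_snd, inv_snd, inv_mul_cancel])

variable (L hL) in
/-- The projection of the extension. -/
def proj : CocycleExt L hL →* H where
  toFun x := x.snd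
  map_one' := rfl
  map_mul' _ _ := rfl

lemma proj_surjective : Function.Surjective (proj L hL) := fun g => ⟨⟨0, g⟩, rfl⟩

variable (L hL) in
/-- The central subgroup of the extension. -/
noncomputable def cen : Multiplicative N →* CocycleExt L hL where
  toFun x := ⟨x.toAdd - L (Finsupp.single (1, 1) 1), 1⟩
  map_one' := by
    refine CocycleExt.ext ?_ rfl
    rw [one_fst, toAdd_one, zero_sub]
  map_mul' x y := by
    refine CocycleExt.ext ?_ ?_
    · rw [mul_fst, toAdd_mul]
      change _ = (x.toAdd - L (Finsupp.single (1, 1) 1)) + (y.toAdd - L (Finsupp.single (1, 1) 1)) +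
        L (Finsupp.single (1, 1) 1)
      rw [add_assoc _ _ (L _), sub_add_cancel, add_sub_right_comm]
    · rw [mul_snd, one_mul]

lemma mul_cen (x : CocycleExt L hL) (c : Multiplicative N) :
    x * cen L hL c = ⟨x.fst + c.toAdd, x.snd⟩ := by
  refine CocycleExt.ext ?_ (mul_one _)
  rw [mul_fst]
  change x.fst + (c.toAdd - L (Finsupp.single (1, 1) 1)) + L (Finsupp.single (x.snd, 1) 1) = _
  rw [cocycle_one_right hL x.snd, add_assoc, sub_add_cancel]

lemma cen_mul (x : CocycleExt L hL) (c : Multiplicative N) :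
    cen L hL c * x = ⟨x.fst + c.toAdd, x.snd⟩ := by
  refine CocycleExt.ext ?_ (one_mul _)
  rw [mul_fst]
  change c.toAdd - L (Finsupp.single (1, 1) 1) + x.fst + L (Finsupp.single (1, x.snd) 1) = _
  rw [cocycle_one_left hL x.snd, add_right_comm, sub_add_cancel, add_comm]

lemma cen_comm (x : CocycleExt L hL) (c : Multiplicative N) :
    x * cen L hL c = cen L hL c * x := by
  rw [mul_cen, cen_mul]

lemma proj_cen (c : Multiplicative N) : proj L hL (cen L hL c) = 1 := rfl

lemma exists_eq_mul_cen {x y : CocycleExt L hL} (h : x.snd = y.snd) :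
    x = y * cen L hL (Multiplicative.ofAdd (x.fst - y.fst)) := by
  rw [mul_cen]
  exact CocycleExt.ext (by rw [toAdd_ofAdd, add_sub_cancel]) h

lemma ker_proj_le_center : (proj L hL).ker ≤ Subgroup.center (CocycleExt L hL) := by
  intro x hx
  have h := exists_eq_mul_cen (x := x) (y := 1) hx
  rw [one_mul] at h
  rw [h, Subgroup.mem_center_iff]
  exact fun y => cen_comm y _

/-- The extension splits over a perfect group on whose cycles the cocycle vanishes. -/
lemma exists_splitting {A : Type*} [Group A] (hA : commutator A = ⊤) (φ : A →* H)
    (hφ : ∀ z, barD2 A z = 0 → L (mapC2 φ z) = 0) :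
    ∃ s : A →* CocycleExt L hL, ∀ a, proj L hL (s a) = φ a := by
  obtain ⟨β, hβ⟩ := exists_cobounding hA (L.comp (mapC2 φ)) hφ
  refine ⟨MonoidHom.mk' (fun a => ⟨-β a, φ a⟩) fun a b => CocycleExt.ext ?_ (map_mul _ _ _),
    fun a => rfl⟩
  have := hβ a b
  rw [LinearMap.comp_apply, mapC2_single] at this
  rw [mul_fst]
  change -β (a * b) = -β a + -β b + L (Finsupp.single (φ a, φ b) 1)
  rw [this]
  abel

/-- The extension splits along `φ` if it splits along `φ` over a subgroup which detects splittings
of central extensions. -/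
lemma exists_splitting_of_subgroup {A : Type*} [Group A] {Γ : Subgroup A} (φ : A →* H)
    (hΓ : ∀ (E : Subgroup (A × CocycleExt L hL)) (p : E →* A), Function.Surjective p →
      p.ker ≤ Subgroup.center E → ∀ σ : Γ →* E, (∀ γ, p (σ γ) = γ) →
      ∃ s : A →* E, ∀ a, p (s a) = a)
    (σ : Γ →* CocycleExt L hL) (hσ : ∀ γ, proj L hL (σ γ) = φ γ) :
    ∃ s : A →* CocycleExt L hL, ∀ a, proj L hL (s a) = φ a := by
  let E : Subgroup (A × CocycleExt L hL) :=
    (φ.comp (MonoidHom.fst A _)).eqLocus ((proj L hL).comp (MonoidHom.snd A _))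
  have hE (x : E) : φ x.1.1 = proj L hL x.1.2 := x.2
  have key : ∃ s : A →* E, ∀ a, (s a).1.1 = a := by
    refine hΓ E ((MonoidHom.fst A _).comp E.subtype) (fun a => ?_) ?_
      ((Γ.subtype.prod σ).codRestrict E fun γ => (hσ γ).symm) fun γ => rfl
    · obtain ⟨x, hx⟩ := proj_surjective (L := L) (hL := hL) (φ a)
      exact ⟨⟨(a, x), hx.symm⟩, rfl⟩
    · intro x hx
      have hx1 : x.1.1 = 1 := hx
      have hx2 : x.1.2 ∈ Subgroup.center (CocycleExt L hL) := by
        refine ker_proj_le_center ?_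
        rw [MonoidHom.mem_ker, ← hE x, hx1, map_one]
      rw [Subgroup.mem_center_iff] at hx2 ⊢
      intro y
      refine Subtype.ext (Prod.ext ?_ (hx2 y.1.2))
      change y.1.1 * x.1.1 = x.1.1 * y.1.1
      rw [hx1, mul_one, one_mul]
  obtain ⟨s, hs⟩ := key
  refine ⟨(MonoidHom.snd A _).comp (E.subtype.comp s), fun a => ?_⟩
  have h := hE (s a)
  rw [hs] at h
  exact h.symm

end CocycleExt

/-- A central extension with a set-theoretic section defines a two-cocycle. -/
lemma exists_cocycle_of_extension {E M : Type*} [Group E] [CommGroup M] (π : E →* H)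
    (hπ : Function.Surjective π) (ι : M →* E) (hι : Function.Injective ι)
    (hcomm : ∀ m x, x * ι m = ι m * x) (hker : π.ker = ι.range) :
    ∃ (L : ((H × H) →₀ ℤ) →ₗ[ℤ] Additive M) (μ : E → Additive M), (∀ t, L (barD3 H t) = 0) ∧
      (∀ x y, μ (x * y) = μ x + μ y + L (Finsupp.single (π x, π y) 1)) ∧
      ∀ m x, μ (ι m * x) = Additive.ofMul m + μ x := by
  choose τ hτ using hπ
  have hex (x : E) : ∃ m, ι m = x * (τ (π x))⁻¹ := by
    have : x * (τ (π x))⁻¹ ∈ π.ker := by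
      rw [MonoidHom.mem_ker, map_mul, map_inv, hτ, mul_inv_cancel]
    rwa [hker] at this
  choose μ hμ using hex
  have hx (x : E) : x = ι (μ x) * τ (π x) := by rw [hμ, inv_mul_cancel_right]
  have hπι (m : M) : π (ι m) = 1 := by
    have : ι m ∈ π.ker := hker ▸ ⟨m, rfl⟩
    exact this
  have hmul (m : M) (x : E) : μ (ι m * x) = m * μ x := by
    apply hι
    rw [hμ, map_mul, map_mul, hπι, one_mul, hμ, mul_assoc]
  have hτ1 (g : H) : μ (τ g) = 1 := by
    apply hι
    rw [hμ, hτ, mul_inv_cancel, map_one]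
  have key (x y : E) : μ (x * y) = μ x * μ y * μ (τ (π x) * τ (π y)) := by
    conv_lhs => rw [hx x, hx y]
    rw [mul_assoc, ← mul_assoc (τ (π x)), hcomm, mul_assoc, hmul, hmul, mul_assoc]
  let L : ((H × H) →₀ ℤ) →ₗ[ℤ] Additive M :=
    Finsupp.linearCombination ℤ fun p => Additive.ofMul (μ (τ p.1 * τ p.2))
  have hL (g k : H) : L (Finsupp.single (g, k) 1) = Additive.ofMul (μ (τ g * τ k)) := by
    simp [L]
  refine ⟨L, fun x => Additive.ofMul (μ x), comp_barD3_of_cocycle L fun g h k => ?_, fun x y => ?_,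
    fun m x => ?_⟩
  · rw [hL, hL, hL, hL, ← ofMul_mul, ← ofMul_mul]
    congr 1
    have h1 := key (τ g * τ h) (τ k)
    have h2 := key (τ g) (τ h * τ k)
    rw [map_mul, hτ, hτ, hτ, hτ1, mul_one] at h1
    rw [map_mul, hτ, hτ, hτ, hτ1, one_mul] at h2
    rw [← h1, ← h2, mul_assoc]
  · change Additive.ofMul (μ (x * y)) = Additive.ofMul (μ x) + Additive.ofMul (μ y) + _
    rw [hL, key x y, ofMul_mul, ofMul_mul]
  · change Additive.ofMul (μ (ι m * x)) = Additive.ofMul m + Additive.ofMul (μ x)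
    rw [hmul, ofMul_mul]

end CocycleExt

section Comparison

variable {E M H N : Type*} [Group E] [CommGroup M] [Group H] [AddCommGroup N]

/-- A homomorphism between central extensions transports the class of one to that of the other. -/
lemma eq_of_extension_hom {π : E →* H} (hπ : Function.Surjective π) {ι : M →* E}
    (hker : π.ker = ι.range) {L' : ((H × H) →₀ ℤ) →ₗ[ℤ] Additive M} {μ : E → Additive M}
    (hμ : ∀ x y, μ (x * y) = μ x + μ y + L' (Finsupp.single (π x, π y) 1))
    (hμι : ∀ m x, μ (ι m * x) = Additive.ofMul m + μ x)
    {L : ((H × H) →₀ ℤ) →ₗ[ℤ] N} {hL : ∀ t, L (barD3 H t) = 0} {Θ : E →* CocycleExt L hL}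
    (hΘ : ∀ x, (Θ x).snd = π x) {Ψ : Additive M →+ N}
    (hΘι : ∀ m, Θ (ι m) = CocycleExt.cen L hL (Multiplicative.ofAdd (Ψ (Additive.ofMul m))))
    {z : (H × H) →₀ ℤ} (hz : barD2 H z = 0) : L z = Ψ (L' z) := by
  have hd (x y : E) (h : π x = π y) : (Θ x).fst - Ψ (μ x) = (Θ y).fst - Ψ (μ y) := by
    have hm : x * y⁻¹ ∈ π.ker := by
      rw [MonoidHom.mem_ker, map_mul, map_inv, h, mul_inv_cancel]
    rw [hker] at hm
    obtain ⟨m, hm⟩ := hm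
    rw [eq_mul_inv_iff_mul_eq] at hm
    rw [← hm, map_mul, hΘι, CocycleExt.cen_mul, hμι, map_add, add_comm (Ψ _) (Ψ (μ y))]
    exact add_sub_add_right_eq_sub _ _ _
  choose τ hτ using hπ
  rw [← sub_eq_zero]
  refine eq_zero_of_cobounding (L - Ψ.toIntLinearMap.comp L')
    (fun g => Ψ (μ (τ g)) - (Θ (τ g)).fst) (fun g k => ?_) hz
  have h := hd (τ (g * k)) (τ g * τ k) (by rw [map_mul, hτ, hτ, hτ])
  rw [map_mul, CocycleExt.mul_fst, hΘ, hΘ, hμ, hτ, hτ, map_add, map_add] at h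
  rw [← neg_sub (Θ (τ (g * k))).fst, h]
  change L (Finsupp.single (g, k) 1) - Ψ (L' (Finsupp.single (g, k) 1)) = _
  abel

end Comparison

section TwistedAmalgam

open TwistedAmalgam

variable {A G M : Type} [Group A] [Group G] [CommGroup M]

lemma eq_one_of_perfect {K : Type*} [CommGroup K] (hA : commutator A = ⊤) (κ : A →* K) (a : A) :
    κ a = 1 := by
  have h : commutator A ≤ κ.ker := Abelianization.commutator_subset_ker κ
  rw [hA] at h
  exact h (Subgroup.mem_top a)

/-- The class of a twisted amalgam of perfect groups with surjective twist generates the kernel of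
the extension. -/
lemma eq_top_of_twistedAmalgam (hA : commutator A = ⊤) (hG : commutator G = ⊤) {Γ : Subgroup A}
    {W : Γ →* Γ} {χ : Γ →* M} (hχ : Function.Surjective χ) {π : TwistedAmalgam W χ →* G}
    {L : ((G × G) →₀ ℤ) →ₗ[ℤ] Additive M} {μ : TwistedAmalgam W χ → Additive M}
    (hμ : ∀ x y, μ (x * y) = μ x + μ y + L (Finsupp.single (π x, π y) 1))
    (hμc : ∀ m x, μ (cen W χ m * x) = Additive.ofMul m + μ x)
    (hπc : ∀ m, π (cen W χ m) = 1)
    (P : Submodule ℤ (Additive M)) (hP : ∀ z, barD2 G z = 0 → L z ∈ P) : P = ⊤ := by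
  obtain ⟨β, hβ⟩ := exists_cobounding hG (P.mkQ.comp L) fun z hz =>
    (Submodule.Quotient.mk_eq_zero _).mpr (hP z hz)
  let κ : TwistedAmalgam W χ →* Multiplicative (Additive M ⧸ P) := MonoidHom.mk'
    (fun x => Multiplicative.ofAdd (P.mkQ (μ x) + β (π x))) fun x y => by
      have h := hβ (π x) (π y)
      rw [LinearMap.comp_apply] at h
      have h' : P.mkQ (μ (x * y)) + β (π (x * y)) =
          P.mkQ (μ x) + β (π x) + (P.mkQ (μ y) + β (π y)) := by
        rw [hμ, map_add, map_add, h, map_mul]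
        abel
      exact congrArg Multiplicative.ofAdd h'
  have hκ (x) : κ x = Multiplicative.ofAdd (P.mkQ (μ x) + β (π x)) := rfl
  have hκ1 (i : Bool) (a : A) : κ (inj W χ i a) = 1 :=
    eq_one_of_perfect hA (κ.comp (inj W χ i)) a
  rw [eq_top_iff]
  intro m _
  obtain ⟨γ, hγ⟩ := hχ m.toMul
  have h : κ (cen W χ (χ γ)) = 1 := by
    have := congrArg κ (inj_false_eq W χ γ)
    rwa [map_mul, hκ1, hκ1, one_mul, eq_comm] at this
  have h1 := hκ (cen W χ (χ γ) * 1)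
  rw [map_mul, h, one_mul, hκ, hμc, map_mul, hπc, one_mul, hγ, ofMul_toMul] at h1
  have h2 : P.mkQ (μ 1) + β (π 1) = P.mkQ (m + μ 1) + β (π 1) :=
    Multiplicative.ofAdd.injective h1
  rw [map_add P.mkQ, add_assoc, eq_comm, add_eq_right] at h2
  exact (Submodule.Quotient.mk_eq_zero _).mp h2

/-- The cokernel of `H₂(A) → H₂(G)` for an amalgam `G` of two copies of the perfect group `A`. -/
theorem nonempty_coker_equiv (hA : commutator A = ⊤) (hG : commutator G = ⊤) {ι₀ ι₁ : A →* G}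
    {Γ : Subgroup A} {W : Γ →* Γ} (hW : ∀ γ, W (W γ) = γ) (h01 : ∀ γ : Γ, ι₁ (W γ).1 = ι₀ γ.1)
    {χ : Γ →* M} (hχ : Function.Surjective χ)
    (hfactor : ∀ {K : Type} [CommGroup K] (θ : Γ →* K), ∃ Ψ : M →* K, ∀ γ, θ γ = Ψ (χ γ))
    (hΓ : ∀ {E : Type} [Group E] (p : E →* A), Function.Surjective p →
      p.ker ≤ Subgroup.center E → ∀ σ : Γ →* E, (∀ γ, p (σ γ) = γ) →
      ∃ s : A →* E, ∀ a, p (s a) = a)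
    {π : TwistedAmalgam W χ →* G} (hπ0 : ∀ a, π (inj W χ false a) = ι₀ a)
    (hπ1 : ∀ a, π (inj W χ true a) = ι₁ a) (hπ : Function.Surjective π)
    (hker : π.ker = (cen W χ).range) :
    Nonempty ((H2 G ⧸ LinearMap.range (mapH2 ι₀)) ≃+ Additive M) := by
  obtain ⟨L, hLmk, hL, hLι⟩ := exists_universal_cocycle hG ι₀
  obtain ⟨s₀, hs₀⟩ := CocycleExt.exists_splitting (hL := hL) hA ι₀ hLι
  obtain ⟨s₁, hs₁⟩ := CocycleExt.exists_splitting_of_subgroup ι₁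
    (fun E p hp hk σ hσ => hΓ p hp hk σ hσ) ((s₀.comp Γ.subtype).comp W) fun γ => by
      rw [MonoidHom.comp_apply, MonoidHom.comp_apply, hs₀, Subgroup.subtype_apply, ← h01, hW]
  have hs (γ : Γ) : (s₀ γ.1).snd = (s₁ (W γ).1).snd :=
    (hs₀ γ.1).trans ((h01 γ).symm.trans (hs₁ (W γ).1).symm)
  let θ : Γ →* Multiplicative (H2 G ⧸ LinearMap.range (mapH2 ι₀)) := MonoidHom.mk'
    (fun γ => Multiplicative.ofAdd ((s₀ γ.1).fst - (s₁ (W γ).1).fst)) fun γ δ => by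
      rw [← ofAdd_add]
      congr 1
      rw [Subgroup.coe_mul, map_mul, map_mul, Subgroup.coe_mul, map_mul, CocycleExt.mul_fst,
        CocycleExt.mul_fst, hs, hs]
      abel
  obtain ⟨Ψ, hΨ⟩ := hfactor θ
  obtain ⟨Θ, hΘ, hΘc⟩ := exists_lift W χ (fun i => Bool.rec s₀ s₁ i)
    ((CocycleExt.cen L hL).comp Ψ) (fun i a m => CocycleExt.cen_comm _ _) fun γ => by
      rw [MonoidHom.comp_apply, ← hΨ]
      exact CocycleExt.exists_eq_mul_cen (hs γ)
  have hπc (m : M) : π (cen W χ m) = 1 := by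
    have : cen W χ m ∈ π.ker := hker ▸ ⟨m, rfl⟩
    exact this
  have hΘπ : (CocycleExt.proj L hL).comp Θ = π := by
    refine hom_ext W χ (fun i a => ?_) fun m => ?_
    · rw [MonoidHom.comp_apply, hΘ]
      cases i
      · exact (hs₀ a).trans (hπ0 a).symm
      · exact (hs₁ a).trans (hπ1 a).symm
    · rw [MonoidHom.comp_apply, hΘc, MonoidHom.comp_apply, CocycleExt.proj_cen, hπc]
  obtain ⟨L', μ, hL', hμ, hμc⟩ := exists_cocycle_of_extension π hπ (cen W χ)
    (cen_injective W χ (Function.LeftInverse.injective hW)) (cen_comm W χ) hker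
  have hL'ι (z) (hz : barD2 A z = 0) : L' (mapC2 ι₀ z) = 0 := by
    refine eq_zero_of_cobounding (L'.comp (mapC2 ι₀)) (fun a => -μ (inj W χ false a))
      (fun a b => ?_) hz
    rw [LinearMap.comp_apply, mapC2_single, map_mul, hμ, hπ0, hπ0]
    abel
  obtain ⟨Φ, hΦ⟩ := exists_coker_hom ι₀ L' hL' hL'ι
  have hΦΨ (z : LinearMap.ker (barD2 G)) :
      L z = Ψ.toAdditiveLeft (L' z) :=
    eq_of_extension_hom hπ hker hμ hμc (DFunLike.congr_fun hΘπ) (fun m => hΘc m) z.2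
  have hsurj (x : H2 G ⧸ LinearMap.range (mapH2 ι₀)) : ∃ z : LinearMap.ker (barD2 G),
      Submodule.Quotient.mk (Submodule.Quotient.mk z) = x := by
    obtain ⟨y, rfl⟩ := Submodule.Quotient.mk_surjective _ x
    obtain ⟨z, rfl⟩ := Submodule.Quotient.mk_surjective _ y
    exact ⟨z, rfl⟩
  refine ⟨AddEquiv.ofBijective Φ.toAddMonoidHom ⟨?_, ?_⟩⟩
  · rw [injective_iff_map_eq_zero]
    intro x hx
    obtain ⟨z, rfl⟩ := hsurj x
    have hz : L' z = 0 := (hΦ z).symm.trans hx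
    rw [← hLmk, hΦΨ, hz, map_zero]
  · have := eq_top_of_twistedAmalgam hA hG hχ hμ hμc hπc (LinearMap.range Φ) fun z hz =>
      ⟨_, hΦ ⟨z, hz⟩⟩
    exact LinearMap.range_eq_top.mp this

end TwistedAmalgam

/-- if `ℤ_S` has a unit `λ` with `λ² − 1` a unit and `q ∉ S` is prime, then the
cokernel of `H₂(SL₂(ℤ_S), ℤ) → H₂(SL₂(ℤ_{S∪{q}}), ℤ)` is isomorphic to `(ℤ/qℤ)^×`. -/
theorem stmt12 (S : Set ℕ) (hS : S.Nonempty) (hSprime : ∀ p ∈ S, Nat.Prime p)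
    (hlam : ∃ lam : (ZS S)ˣ, IsUnit ((lam : ZS S) ^ 2 - 1))
    (q : ℕ) (hq : Nat.Prime q) (hqS : q ∉ S) :
    Nonempty
      ((H2 (Matrix.SpecialLinearGroup (Fin 2) (ZS (insert q S))) ⧸
        LinearMap.range (mapH2 (Matrix.SpecialLinearGroup.map (n := Fin 2)
          (Subring.inclusion
            (Subring.closure_mono (Set.image_mono (Set.subset_insert q S))))))) ≃+
        Additive (ZMod q)ˣ) := by
  have := Fact.mk hq
  have hS' : ∀ p ∈ S, p.Prime := hSprime
  have h2 := ZS.two_mem hS' hlam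
  have h3 := ZS.three_mem hS' hlam
  have hT : ∀ p ∈ insert q S, p.Prime := fun p hp => hp.elim (fun h => h ▸ hq) (hS' p)
  obtain ⟨π, hπ0, hπ1, hπ, hker⟩ := ZS.exists_amalgam hS' q hqS (ZS.gammaZeroChar hS' q hqS)
  exact nonempty_coker_equiv (ZS.commutator_eq_top hS' h2 h3)
    (ZS.commutator_eq_top hT (Set.mem_insert_of_mem q h2) (Set.mem_insert_of_mem q h3))
    (SLTwo.involution_involution (ZS.prime_ne_zero q))
    (SLTwo.flip_involution _ _ (ZS.unitOf_eq q)) (ZS.gammaZeroChar_surjective hS' q hqS)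
    (ZS.gammaZeroChar_factor hS' q hqS h2 h3) (ZS.exists_section hS' q hqS h2 h3)
    hπ0 hπ1 hπ hker
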